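/- arXiv:1802.08405 — 5 statements merged into one kernel-verified Lean document; each statement's English description precedes it below -/
import Mathlib

section
/- Let k ≥ 1 be an integer, n a positive integer, p ≥ 0 with np an integer, and x ∈ [0,1]. If Δ > 0 satisfies max{ |x − p|, √(4pk/n) } ≤ Δ, then | g_{k,x}(p) | = | Σ_{l=0}^{k} C(k,l) (−x)^{k−l} ∏_{l'=0}^{l−1} ( p − l'/n ) | ≤ (2Δ)^k. -/
/-- The polynomial `g_{k,x}(p) = Σ_{l=0}^k C(k,l)(-x)^{k-l} Π_{l'=0}^{l-1}(p - l'/n)`. -/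
noncomputable def gfun (n k : ℕ) (x u : ℝ) : ℝ :=
  ∑ l ∈ Finset.range (k + 1), (k.choose l : ℝ) * (-x) ^ (k - l) *
    ∏ l' ∈ Finset.range l, (u - (l' : ℝ) / n)

theorem gfun_zero (n : ℕ) (x u : ℝ) : gfun n 0 x u = 1 := by
  simp [gfun]

theorem gfun_one (n : ℕ) (x u : ℝ) : gfun n 1 x u = u - x := by
  simp [gfun, Finset.sum_range_succ]
  ring

/-- The part of the binomial sum weighted by the complementary index lowers the degree. -/
theorem sum_sub_mul_gfun_summand (n k : ℕ) (x u : ℝ) :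
    ∑ l ∈ Finset.range (k + 2), ((k + 1 : ℝ) - l) * (((k + 1).choose l : ℝ) *
      (-x) ^ (k + 1 - l) * ∏ l' ∈ Finset.range l, (u - (l' : ℝ) / n)) =
      -((k + 1) * x * gfun n k x u) := by
  rw [Finset.sum_range_succ, gfun, Finset.mul_sum, ← Finset.sum_neg_distrib]
  simp only [Nat.cast_add, Nat.cast_one, sub_self, zero_mul, add_zero]
  refine Finset.sum_congr rfl fun l hl => ?_
  have hlk : l ≤ k := Nat.lt_succ_iff.mp (Finset.mem_range.mp hl)
  have hc : (k.choose l : ℝ) * (k + 1) = ((k + 1).choose l : ℝ) * ((k + 1 : ℝ) - l) := by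
    have h := congrArg (Nat.cast (R := ℝ)) (Nat.choose_mul_succ_eq k l)
    rw [Nat.cast_mul, Nat.cast_mul, Nat.cast_sub (by omega)] at h
    exact_mod_cast h
  rw [show k + 1 - l = k - l + 1 by omega, pow_succ]
  linear_combination x * (-x) ^ (k - l) * (∏ l' ∈ Finset.range l, (u - (l' : ℝ) / n)) * hc

/-- Pascal's rule for `gfun`. -/
theorem gfun_succ (n k : ℕ) (x u : ℝ) :
    gfun n (k + 1) x u = -x * gfun n k x u +
      ∑ l ∈ Finset.range (k + 1), (u - (l : ℝ) / n) * ((k.choose l : ℝ) * (-x) ^ (k - l) *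
        ∏ l' ∈ Finset.range l, (u - (l' : ℝ) / n)) := by
  have h := Finset.sum_choose_succ_mul
    (fun i j => (-x) ^ j * ∏ l' ∈ Finset.range i, (u - (l' : ℝ) / n)) k
  simp only [gfun, mul_assoc]
  rw [h, Finset.mul_sum]
  congr 1 <;> refine Finset.sum_congr rfl fun l hl => ?_
  · have hlk : l ≤ k := Nat.lt_succ_iff.mp (Finset.mem_range.mp hl)
    rw [show k + 1 - l = k - l + 1 by omega, pow_succ]
    ring
  · rw [Finset.prod_range_succ]
    ring

/-- The three-term recurrence of the rescaled Charlier polynomials. -/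
theorem gfun_add_two (n k : ℕ) (x u : ℝ) :
    gfun n (k + 2) x u = (u - x - (k + 1) / n) * gfun n (k + 1) x u -
      (k + 1) / n * x * gfun n k x u := by
  have h := sum_sub_mul_gfun_summand n k x u
  rw [gfun_succ n (k + 1)]
  have e : ∑ l ∈ Finset.range (k + 1 + 1), (u - (l : ℝ) / n) * (((k + 1).choose l : ℝ) *
      (-x) ^ (k + 1 - l) * ∏ l' ∈ Finset.range l, (u - (l' : ℝ) / n)) =
      (u - (k + 1) / n) * gfun n (k + 1) x u + (1 / n : ℝ) *
        ∑ l ∈ Finset.range (k + 2), ((k + 1 : ℝ) - l) * (((k + 1).choose l : ℝ) *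
          (-x) ^ (k + 1 - l) * ∏ l' ∈ Finset.range l, (u - (l' : ℝ) / n)) := by
    rw [gfun, Finset.mul_sum, Finset.mul_sum, ← Finset.sum_add_distrib]
    refine Finset.sum_congr rfl fun l _ => ?_
    ring
  rw [e, h]
  ring

/-- A falling product started at a grid point is dominated by the corresponding power. -/
theorem abs_prod_range_sub_div_le {n m : ℕ} (hn : 0 < n) {p : ℝ} (hm : (n : ℝ) * p = m) (l : ℕ) :
    |∏ l' ∈ Finset.range l, (p - (l' : ℝ) / n)| ≤ p ^ l := by
  have hn' : (0 : ℝ) < n := by exact_mod_cast hn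
  have hp : p = m / n := by field_simp; linarith
  have hp0 : 0 ≤ p := by rw [hp]; positivity
  rcases le_or_gt l m with hl | hl
  · rw [Finset.abs_prod]
    calc ∏ l' ∈ Finset.range l, |p - (l' : ℝ) / n| ≤ ∏ _l' ∈ Finset.range l, p := by
          refine Finset.prod_le_prod (fun _ _ => abs_nonneg _) fun i hi => ?_
          have hi' : (i : ℝ) ≤ m := by
            exact_mod_cast (Finset.mem_range.mp hi).le.trans hl
          have h1 : (i : ℝ) / n ≤ p := by rw [hp]; gcongr
          have h2 : 0 ≤ (i : ℝ) / n := by positivity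
          rw [abs_of_nonneg (by linarith)]
          linarith
      _ = p ^ l := by simp
  · rw [Finset.prod_eq_zero (Finset.mem_range.mpr hl) (by rw [hp, sub_self]), abs_zero]
    positivity

/-- The bound obtained by ignoring all cancellation. -/
theorem abs_gfun_le_add_pow {n m : ℕ} (hn : 0 < n) {p x : ℝ} (hm : (n : ℝ) * p = m)
    (hx : 0 ≤ x) (k : ℕ) : |gfun n k x p| ≤ (p + x) ^ k := by
  rw [gfun, add_pow]
  refine (Finset.abs_sum_le_sum_abs _ _).trans (Finset.sum_le_sum fun l _ => ?_)
  rw [abs_mul, abs_mul, abs_pow, abs_neg, abs_of_nonneg hx, Nat.abs_cast]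
  calc (k.choose l : ℝ) * x ^ (k - l) * |∏ l' ∈ Finset.range l, (p - (l' : ℝ) / n)|
      ≤ (k.choose l : ℝ) * x ^ (k - l) * p ^ l := by
        gcongr
        exact abs_prod_range_sub_div_le hn hm l
    _ = p ^ l * x ^ (k - l) * (k.choose l : ℝ) := by ring

/-- The bound obtained from the recurrence when the degree is at most `n * p`. -/
theorem abs_gfun_le_of_div_le {n k : ℕ} {p x Δ : ℝ} (hx : 0 ≤ x) (hΔ : 0 < Δ)
    (h₁ : |x - p| ≤ Δ) (h₂ : 4 * (p * (k / n)) ≤ Δ ^ 2) (hk : (k / n : ℝ) ≤ p) :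
    ∀ j ≤ k, |gfun n j x p| ≤ (2 * Δ) ^ j := by
  obtain ⟨h₁l, h₁r⟩ := abs_le.mp h₁
  have hk0 : (0 : ℝ) ≤ k / n := by positivity
  have hkΔ : 2 * (k / n : ℝ) ≤ Δ := by nlinarith
  intro j
  induction j using Nat.twoStepInduction with
  | zero => simp [gfun_zero]
  | one =>
    intro _
    rw [gfun_one, pow_one, abs_sub_comm]
    linarith
  | more j ih₀ ih₁ =>
    intro hj
    have h₀ := ih₀ (by omega)
    have h₁ := ih₁ (by omega)
    have ht0 : (0 : ℝ) ≤ (j + 1) / n := by positivity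
    have htk : ((j + 1) / n : ℝ) ≤ k / n := by
      gcongr
      exact_mod_cast (by omega : j + 1 ≤ k)
    rw [gfun_add_two]
    generalize ((j + 1) / n : ℝ) = t at *
    generalize (k / n : ℝ) = s at *
    have hc : |p - x - t| ≤ Δ + t := abs_le.mpr ⟨by linarith, by linarith⟩
    have hs : (Δ + t) * (2 * Δ) + t * x ≤ (2 * Δ) ^ 2 := by
      have hpt : p * t ≤ p * s := by gcongr; linarith
      nlinarith
    calc |(p - x - t) * gfun n (j + 1) x p - t * x * gfun n j x p|
        ≤ |p - x - t| * |gfun n (j + 1) x p| + t * x * |gfun n j x p| := by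
          refine (abs_sub _ _).trans_eq ?_
          rw [abs_mul, abs_mul, abs_of_nonneg (mul_nonneg ht0 hx)]
      _ ≤ (Δ + t) * (2 * Δ) ^ (j + 1) + t * x * (2 * Δ) ^ j := by gcongr
      _ = ((Δ + t) * (2 * Δ) + t * x) * (2 * Δ) ^ j := by ring
      _ ≤ (2 * Δ) ^ 2 * (2 * Δ) ^ j := by gcongr
      _ = (2 * Δ) ^ (j + 2) := by ring

theorem stmt14 (k n : ℕ) (hk : 1 ≤ k) (hn : 0 < n) (p : ℝ) (hp : 0 ≤ p)
    (hnp : ∃ m : ℕ, (n : ℝ) * p = (m : ℝ)) (x : ℝ) (hx : x ∈ Set.Icc (0 : ℝ) 1)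
    (Δ : ℝ) (hΔ : 0 < Δ) (h₁ : |x - p| ≤ Δ) (h₂ : Real.sqrt (4 * p * k / n) ≤ Δ) :
    |gfun n k x p| ≤ (2 * Δ) ^ k := by
  obtain ⟨m, hm⟩ := hnp
  have h₃ : 4 * (p * (k / n)) ≤ Δ ^ 2 := by
    have h := (Real.sqrt_le_left hΔ.le).mp h₂
    calc 4 * (p * (k / n)) = 4 * p * k / n := by ring
      _ ≤ Δ ^ 2 := h
  rcases le_total (k / n : ℝ) p with h | h
  · exact abs_gfun_le_of_div_le hx.1 hΔ h₁ h₃ h k le_rfl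
  · have hpΔ : 2 * p ≤ Δ := by nlinarith
    refine (abs_gfun_le_add_pow hn hm hx.1 k).trans ?_
    have hx0 := hx.1
    have hxp := (abs_le.mp h₁).2
    gcongr
    linarith
end

section
/- Let {P_θ : θ ∈ Θ'} be a family of probability distributions for an observation Z (a Markov kernel θ ↦ P_θ on a measurable space), let Θ ⊆ Θ', and let T : Θ' → ℝ. Let σ₀ and σ₁ be prior probability distributions on Θ'. Suppose there exist ζ ∈ ℝ, s > 0, and 0 ≤ β₀, β₁ < 1 such that σ₀( {θ ∈ Θ : T(θ) ≤ ζ − s} ) ≥ 1 − β₀ and σ₁( {θ ∈ Θ : T(θ) ≥ ζ + s} ) ≥ 1 − β₁. Then for every estimator T̂ = T̂(Z), sup_{θ ∈ Θ} ℙ_θ( |T̂ − T(θ)| ≥ s ) ≥ (1 − V(F₁, F₀) − β₀ − β₁)/2, where F_i = ∫ P_θ σ_i(dθ) is the marginal distribution of Z under prior σ_i (i = 0, 1) and V denotes total variation distance. -/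
open MeasureTheory

/-- Total variation distance between two measures: `sup_A |P(A) - Q(A)|` over measurable `A`. -/
noncomputable def tvDist {Z : Type*} [MeasurableSpace Z] (P Q : Measure Z) : ℝ :=
  sSup { r | ∃ A : Set Z, MeasurableSet A ∧ r = |(P A).toReal - (Q A).toReal| }

/-- The difference of two probability measures on a measurable set is at most their total
variation distance. -/
lemma toReal_sub_toReal_le_tvDist {Z : Type*} [MeasurableSpace Z] (P Q : Measure Z)
    [IsProbabilityMeasure P] [IsProbabilityMeasure Q] {A : Set Z} (hA : MeasurableSet A) :
    (P A).toReal - (Q A).toReal ≤ tvDist P Q := by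
  refine (le_abs_self _).trans (le_csSup ⟨1, ?_⟩ ⟨A, hA, rfl⟩)
  rintro _ ⟨B, -, rfl⟩
  have hP : P.real B ≤ 1 := measureReal_le_one
  have hQ : Q.real B ≤ 1 := measureReal_le_one
  have hP' : 0 ≤ P.real B := measureReal_nonneg
  have hQ' : 0 ≤ Q.real B := measureReal_nonneg
  simp only [measureReal_def] at hP hQ hP' hQ'
  rw [abs_le]
  constructor <;> linarith

/-- If a Markov kernel gives `B` mass at most `r` on a (not necessarily measurable) set `A` of
parameters of prior outer measure at least `1 - β`, then the mixture gives `B` mass at most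
`r + β`. -/
lemma toReal_bind_le_add {Θ Z : Type*} [MeasurableSpace Θ] [MeasurableSpace Z]
    (P : ProbabilityTheory.Kernel Θ Z) [ProbabilityTheory.IsMarkovKernel P]
    (σ : Measure Θ) [IsProbabilityMeasure σ] {A : Set Θ} {B : Set Z} {r β : ℝ}
    (hr : 0 ≤ r) (hβ : 0 ≤ β) (hA : ENNReal.ofReal (1 - β) ≤ σ A) (hB : MeasurableSet B)
    (h : ∀ θ ∈ A, (P θ B).toReal ≤ r) :
    ((σ.bind fun θ => P θ) B).toReal ≤ r + β := by
  have hmeas : Measurable fun θ => P θ B := P.measurable_coe hB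
  let M : Set Θ := {θ | P θ B ≤ ENNReal.ofReal r}
  have hMm : MeasurableSet M := measurableSet_le hmeas measurable_const
  have hAM : A ⊆ M := fun θ hθ =>
    (ENNReal.le_ofReal_iff_toReal_le (measure_ne_top _ _) hr).2 (h θ hθ)
  have hMc : σ Mᶜ ≤ ENNReal.ofReal β := by
    rw [prob_compl_eq_one_sub hMm, tsub_le_iff_right]
    calc (1 : ENNReal) = ENNReal.ofReal (β + (1 - β)) := by simp
      _ ≤ ENNReal.ofReal β + ENNReal.ofReal (1 - β) := ENNReal.ofReal_add_le
      _ ≤ ENNReal.ofReal β + σ M := by gcongr; exact hA.trans (measure_mono hAM)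
  refine ENNReal.toReal_le_of_le_ofReal (by positivity) ?_
  rw [Measure.bind_apply hB P.measurable.aemeasurable, ENNReal.ofReal_add hr hβ]
  calc ∫⁻ θ, P θ B ∂σ ≤ ∫⁻ θ, (ENNReal.ofReal r + Mᶜ.indicator 1 θ) ∂σ := by
        refine lintegral_mono fun θ => ?_
        by_cases hθ : θ ∈ M
        · exact le_add_right hθ
        · have : θ ∈ Mᶜ := hθ
          simpa [this] using le_add_left (prob_le_one (μ := P θ) (s := B))
    _ = ENNReal.ofReal r + σ Mᶜ := by
        rw [lintegral_add_left measurable_const, lintegral_indicator_one hMm.compl]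
        simp
    _ ≤ _ := by gcongr

theorem stmt15 {Θ' Z : Type*} [MeasurableSpace Θ'] [MeasurableSpace Z]
    (P : ProbabilityTheory.Kernel Θ' Z) [ProbabilityTheory.IsMarkovKernel P]
    (Θ : Set Θ') (T : Θ' → ℝ)
    (σ₀ σ₁ : Measure Θ') [IsProbabilityMeasure σ₀] [IsProbabilityMeasure σ₁]
    (ζ s β₀ β₁ : ℝ) (hs : 0 < s)
    (hβ₀0 : 0 ≤ β₀) (hβ₀1 : β₀ < 1) (hβ₁0 : 0 ≤ β₁) (hβ₁1 : β₁ < 1)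
    (h₀ : ENNReal.ofReal (1 - β₀) ≤ σ₀ {θ | θ ∈ Θ ∧ T θ ≤ ζ - s})
    (h₁ : ENNReal.ofReal (1 - β₁) ≤ σ₁ {θ | θ ∈ Θ ∧ ζ + s ≤ T θ})
    (That : Z → ℝ) (hThat : Measurable That) :
    (1 - tvDist (σ₁.bind fun θ => P θ) (σ₀.bind fun θ => P θ) - β₀ - β₁) / 2 ≤
      ⨆ θ ∈ Θ, ((P θ) {z | s ≤ |That z - T θ|}).toReal := by
  set r := ⨆ θ ∈ Θ, ((P θ) {z | s ≤ |That z - T θ|}).toReal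
  have hle_one (θ : Θ') (E : Set Z) : (P θ E).toReal ≤ 1 := measureReal_le_one (μ := P θ)
  have hr0 : 0 ≤ r := Real.iSup_nonneg fun θ => Real.iSup_nonneg fun _ => ENNReal.toReal_nonneg
  have hle {θ : Θ'} (hθ : θ ∈ Θ) : ((P θ) {z | s ≤ |That z - T θ|}).toReal ≤ r := by
    have hbdd : BddAbove (Set.range fun θ => ⨆ _ : θ ∈ Θ,
        ((P θ) {z | s ≤ |That z - T θ|}).toReal) := by
      refine ⟨1, ?_⟩
      rintro _ ⟨θ, rfl⟩
      exact Real.iSup_le (fun _ => hle_one _ _) zero_le_one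
    simpa [hθ] using le_ciSup hbdd θ
  have hle_of_subset {θ : Θ'} (hθ : θ ∈ Θ) {E : Set Z} (hE : E ⊆ {z | s ≤ |That z - T θ|}) :
      (P θ E).toReal ≤ r :=
    (ENNReal.toReal_mono (measure_ne_top _ _) (measure_mono hE)).trans (hle hθ)
  have hB : MeasurableSet {z | ζ ≤ That z} := measurableSet_le measurable_const hThat
  have hF₀ := toReal_bind_le_add P σ₀ hr0 hβ₀0 h₀ hB fun θ ⟨hθ, (hT : T θ ≤ ζ - s)⟩ =>
    hle_of_subset hθ fun z (hz : ζ ≤ That z) =>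
      (show s ≤ That z - T θ by linarith).trans (le_abs_self _)
  have hF₁ := toReal_bind_le_add P σ₁ hr0 hβ₁0 h₁ hB.compl fun θ ⟨hθ, (hT : ζ + s ≤ T θ)⟩ =>
    hle_of_subset hθ fun z (hz : ¬ ζ ≤ That z) =>
      (show s ≤ -(That z - T θ) by linarith).trans (neg_le_abs _)
  have : IsProbabilityMeasure (σ₀.bind fun θ => P θ) :=
    inferInstanceAs (IsProbabilityMeasure (σ₀.bind P))
  have : IsProbabilityMeasure (σ₁.bind fun θ => P θ) :=
    inferInstanceAs (IsProbabilityMeasure (σ₁.bind P))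
  have hV := toReal_sub_toReal_le_tvDist (σ₁.bind fun θ => P θ) (σ₀.bind fun θ => P θ) hB
  have hcompl : ((σ₁.bind fun θ => P θ) {z | ζ ≤ That z}ᶜ).toReal =
      1 - ((σ₁.bind fun θ => P θ) {z | ζ ≤ That z}).toReal :=
    probReal_compl_eq_one_sub hB
  linarith
end

section
/- Let I = [a, b] be a compact interval with a > 0, let K > 0 be an integer, and let f be a continuous function on I. Let E_K(f; I) = inf over polynomials P of degree at most K of sup_{x ∈ I} |P(x) − f(x)| denote the best uniform polynomial approximation error. Then 2·E_K(f; I) equals the maximum, over all pairs of Borel probability measures ν₀ and ν₁ supported on I satisfying ∫ t^l ν₁(dt) = ∫ t^l ν₀(dt) for every l = 0, 1, …, K, of the quantity ∫ f(t) ν₁(dt) − ∫ f(t) ν₀(dt); moreover this maximum is attained. -/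
open MeasureTheory

/-- The best uniform approximation error of `f` on `[a,b]` by polynomials of degree at most
`K`. -/
noncomputable def EK (K : ℕ) (a b : ℝ) (f : ℝ → ℝ) : ℝ :=
  sInf { r | ∃ c : Fin (K + 1) → ℝ,
    r = sSup ((fun x => |(∑ i, c i * x ^ (i : ℕ)) - f x|) '' Set.Icc a b) }

/-- In finite dimension, the convex hull of a compact set is compact, by Carathéodory's theorem. -/
theorem isCompact_convexHull {E : Type*} [NormedAddCommGroup E] [NormedSpace ℝ E]
    [FiniteDimensional ℝ E] {s : Set E} (hs : IsCompact s) : IsCompact (convexHull ℝ s) := by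
  have h : convexHull ℝ s = ⋃ m ∈ Set.Iic (Module.finrank ℝ E + 1),
      (fun p : (Fin m → ℝ) × (Fin m → E) => ∑ i, p.1 i • p.2 i) ''
        (stdSimplex ℝ (Fin m) ×ˢ Set.univ.pi fun _ => s) := by
    refine Set.Subset.antisymm (fun x hx => ?_) ?_
    · obtain ⟨ι, _, z, w, hz, hind, hw, hw1, rfl⟩ := eq_pos_convex_span_of_mem_convexHull hx
      have hcard : Fintype.card ι ≤ Module.finrank ℝ E + 1 :=
        hind.card_le_finrank_succ.trans (Nat.succ_le_succ (Submodule.finrank_le _))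
      let e := (Fintype.equivFin ι).symm
      refine Set.mem_biUnion hcard ⟨(w ∘ e, z ∘ e),
        ⟨⟨fun i => (hw _).le, ?_⟩, fun i _ => hz ⟨_, rfl⟩⟩, ?_⟩
      · exact (e.sum_comp w).trans hw1
      · exact e.sum_comp fun i => w i • z i
    · refine Set.iUnion₂_subset fun m _ => ?_
      rintro _ ⟨⟨w, z⟩, ⟨hw, hz⟩, rfl⟩
      exact mem_convexHull_of_exists_fintype w z hw.1 hw.2 (fun i => hz i trivial) rfl
  rw [h]
  refine (Set.finite_Iic _).isCompact_biUnion fun m _ => ?_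
  exact ((isCompact_stdSimplex ℝ (Fin m)).prod (isCompact_univ_pi fun _ => hs)).image
    (by fun_prop)

/-- Every point of the convex hull of the image of a compact set is the barycentre of the image of
a probability measure carried by that set. -/
theorem exists_isProbabilityMeasure_integral_eq_of_mem_convexHull
    {E : Type*} [NormedAddCommGroup E] [NormedSpace ℝ E] [CompleteSpace E]
    {s : Set ℝ} (hs : IsCompact s) {φ : ℝ → E} (hφ : ContinuousOn φ s) {z : E}
    (hz : z ∈ convexHull ℝ (φ '' s)) :
    ∃ ν : Measure ℝ, IsProbabilityMeasure ν ∧ ν sᶜ = 0 ∧ ∫ t in s, φ t ∂ν = z := by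
  revert z
  change convexHull ℝ (φ '' s) ⊆
    {z | ∃ ν : Measure ℝ, IsProbabilityMeasure ν ∧ ν sᶜ = 0 ∧ ∫ t in s, φ t ∂ν = z}
  refine convexHull_min ?_ ?_
  · rintro _ ⟨x, hx, rfl⟩
    refine ⟨Measure.dirac x, inferInstance, ?_, ?_⟩
    · rw [Measure.dirac_apply' _ hs.measurableSet.compl]
      simp [hx]
    · classical
      rw [setIntegral_dirac]
      simp [hx]
  · rintro _ ⟨μ, hμ, hμs, rfl⟩ _ ⟨ν, hν, hνs, rfl⟩ p q hp hq hpq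
    refine ⟨ENNReal.ofReal p • μ + ENNReal.ofReal q • ν, ⟨?_⟩, ?_, ?_⟩
    · simp [← ENNReal.ofReal_add hp hq, hpq]
    · simp [hμs, hνs]
    · have h₁ : IntegrableOn φ s μ := hφ.integrableOn_compact hs
      have h₂ : IntegrableOn φ s ν := hφ.integrableOn_compact hs
      rw [Measure.restrict_add, Measure.restrict_smul, Measure.restrict_smul,
        integral_add_measure (h₁.smul_measure ENNReal.ofReal_ne_top)
          (h₂.smul_measure ENNReal.ofReal_ne_top),
        integral_smul_measure, integral_smul_measure, ENNReal.toReal_ofReal hp,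
        ENNReal.toReal_ofReal hq]

theorem EK_le_of_forall_abs_sub_le {K : ℕ} {a b r : ℝ} {f : ℝ → ℝ} (hab : a ≤ b)
    (c : Fin (K + 1) → ℝ)
    (h : ∀ x ∈ Set.Icc a b, |(∑ i, c i * x ^ (i : ℕ)) - f x| ≤ r) : EK K a b f ≤ r := by
  have hbdd : BddBelow { r | ∃ c : Fin (K + 1) → ℝ,
      r = sSup ((fun x => |(∑ i, c i * x ^ (i : ℕ)) - f x|) '' Set.Icc a b) } := by
    refine ⟨0, ?_⟩
    rintro _ ⟨d, rfl⟩
    exact Real.sSup_nonneg (Set.forall_mem_image.2 fun x _ => abs_nonneg _)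
  exact (csInf_le hbdd ⟨c, rfl⟩).trans
    (csSup_le ((Set.nonempty_Icc.2 hab).image _) (Set.forall_mem_image.2 h))

theorem EK_nonneg (K : ℕ) (a b : ℝ) (f : ℝ → ℝ) : 0 ≤ EK K a b f := by
  refine Real.sInf_nonneg ?_
  rintro _ ⟨d, rfl⟩
  exact Real.sSup_nonneg (Set.forall_mem_image.2 fun x _ => abs_nonneg _)

/-- Subtracting the midrange of a function from it halves its oscillation. -/
theorem two_mul_EK_lt_of_forall_sub_lt {K : ℕ} {a b r : ℝ} {f : ℝ → ℝ} (hab : a ≤ b)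
    (hf : ContinuousOn f (Set.Icc a b)) (c : Fin (K + 1) → ℝ)
    (h : ∀ x ∈ Set.Icc a b, ∀ y ∈ Set.Icc a b,
      (f x - ∑ i, c i * x ^ (i : ℕ)) - (f y - ∑ i, c i * y ^ (i : ℕ)) < r) :
    2 * EK K a b f < r := by
  have hg : ContinuousOn (fun x => f x - ∑ i, c i * x ^ (i : ℕ)) (Set.Icc a b) :=
    hf.sub (by fun_prop)
  obtain ⟨u, hu, hmax⟩ := isCompact_Icc.exists_isMaxOn (Set.nonempty_Icc.2 hab) hg
  obtain ⟨v, hv, hmin⟩ := isCompact_Icc.exists_isMinOn (Set.nonempty_Icc.2 hab) hg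
  set g : ℝ → ℝ := fun x => f x - ∑ i, c i * x ^ (i : ℕ) with hgdef
  have key : EK K a b f ≤ (g u - g v) / 2 := by
    refine EK_le_of_forall_abs_sub_le hab (c + Pi.single 0 ((g u + g v) / 2)) fun x hx => ?_
    have hsum : ∑ i : Fin (K + 1),
        (c + Pi.single 0 ((g u + g v) / 2) : Fin (K + 1) → ℝ) i * x ^ (i : ℕ) =
        (∑ i, c i * x ^ (i : ℕ)) + (g u + g v) / 2 := by
      simp [add_mul, Finset.sum_add_distrib, Pi.single_apply]
    have h₁ : g x ≤ g u := hmax hx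
    have h₂ : g v ≤ g x := hmin hx
    have h₃ : g x = f x - ∑ i, c i * x ^ (i : ℕ) := rfl
    rw [hsum, abs_le]
    constructor <;> linarith
  have := h u hu v hv
  change g u - g v < r at this
  linarith

/-- Measures on `[a,b]` that share their first `K` moments cannot separate `f` by more than twice
its approximation error. -/
theorem integral_sub_integral_le_two_mul_EK {K : ℕ} {a b : ℝ} {f : ℝ → ℝ}
    (hf : ContinuousOn f (Set.Icc a b)) {ν₀ ν₁ : Measure ℝ}
    [IsProbabilityMeasure ν₀] [IsProbabilityMeasure ν₁]
    (hmom : ∀ l : ℕ, l ≤ K →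
      (∫ t in Set.Icc a b, t ^ l ∂ν₁) = ∫ t in Set.Icc a b, t ^ l ∂ν₀) :
    (∫ t in Set.Icc a b, f t ∂ν₁) - (∫ t in Set.Icc a b, f t ∂ν₀) ≤ 2 * EK K a b f := by
  suffices h : ((∫ t in Set.Icc a b, f t ∂ν₁) - (∫ t in Set.Icc a b, f t ∂ν₀)) / 2 ≤
      EK K a b f by linarith
  refine le_csInf ⟨_, 0, rfl⟩ ?_
  rintro _ ⟨c, rfl⟩
  set p : ℝ → ℝ := fun x => ∑ i, c i * x ^ (i : ℕ) with hp
  have hpc : ContinuousOn p (Set.Icc a b) := by fun_prop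
  set S := sSup ((fun x => |p x - f x|) '' Set.Icc a b) with hS
  have hle : ∀ x ∈ Set.Icc a b, ‖p x - f x‖ ≤ S := fun x hx =>
    le_csSup (isCompact_Icc.bddAbove_image (hpc.sub hf).abs) ⟨x, hx, rfl⟩
  have hS0 : 0 ≤ S := Real.sSup_nonneg (Set.forall_mem_image.2 fun x _ => abs_nonneg _)
  have hbound : ∀ ν : Measure ℝ, IsProbabilityMeasure ν →
      |(∫ t in Set.Icc a b, p t ∂ν) - ∫ t in Set.Icc a b, f t ∂ν| ≤ S := by
    intro ν hν
    rw [← integral_sub (hpc.integrableOn_compact isCompact_Icc)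
      (hf.integrableOn_compact isCompact_Icc), ← Real.norm_eq_abs]
    refine (norm_setIntegral_le_of_norm_le_const (measure_lt_top ν _) hle).trans ?_
    exact mul_le_of_le_one_right hS0 measureReal_le_one
  have hpint : ∀ ν : Measure ℝ, IsProbabilityMeasure ν →
      ∫ t in Set.Icc a b, p t ∂ν = ∑ i, c i * ∫ t in Set.Icc a b, t ^ (i : ℕ) ∂ν := by
    intro ν hν
    rw [hp, integral_finsetSum]
    · simp_rw [integral_const_mul]
    · intro i _
      exact ContinuousOn.integrableOn_compact isCompact_Icc (by fun_prop)
  have heq : ∫ t in Set.Icc a b, p t ∂ν₁ = ∫ t in Set.Icc a b, p t ∂ν₀ := by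
    rw [hpint ν₁ inferInstance, hpint ν₀ inferInstance]
    exact Finset.sum_congr rfl fun i _ => by rw [hmom i (Nat.lt_succ_iff.1 i.2)]
  have h₀ := abs_le.1 (hbound ν₀ inferInstance)
  have h₁ := abs_le.1 (hbound ν₁ inferInstance)
  linarith [h₀.2, h₁.1]

open scoped Pointwise in
/-- Hahn-Banach duality for uniform polynomial approximation, on the curve
`x ↦ ((1, x, …, x ^ K), f x)`. -/
theorem zero_two_mul_EK_mem_convexHull_sub {K : ℕ} {a b : ℝ} {f : ℝ → ℝ} (hab : a ≤ b)
    (hf : ContinuousOn f (Set.Icc a b)) :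
    ((0 : Fin (K + 1) → ℝ), 2 * EK K a b f) ∈
      convexHull ℝ ((fun x => ((fun i : Fin (K + 1) => x ^ (i : ℕ)), f x)) '' Set.Icc a b) -
      convexHull ℝ ((fun x => ((fun i : Fin (K + 1) => x ^ (i : ℕ)), f x)) '' Set.Icc a b) := by
  set φ : ℝ → (Fin (K + 1) → ℝ) × ℝ := fun x => ((fun i => x ^ (i : ℕ)), f x) with hφdef
  have hφ : ContinuousOn φ (Set.Icc a b) :=
    ContinuousOn.prodMk (by fun_prop) hf
  have hM : IsCompact (convexHull ℝ (φ '' Set.Icc a b)) :=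
    isCompact_convexHull (isCompact_Icc.image_of_continuousOn hφ)
  have hMsub := hM.add hM.neg
  rw [← sub_eq_add_neg] at hMsub
  by_contra hnot
  obtain ⟨L, u, hlt, hu⟩ := geometric_hahn_banach_closed_point
    ((convex_convexHull ℝ _).sub (convex_convexHull ℝ _)) hMsub.isClosed hnot
  set d := L (0, 1) with hd
  set c : Fin (K + 1) → ℝ := fun i => L (Pi.single i 1, 0) with hc
  have hL : ∀ (v : Fin (K + 1) → ℝ) (t : ℝ), L (v, t) = (∑ i, c i * v i) + d * t := by
    intro v t
    have h : (v, t) = (∑ i, v i • ((Pi.single i 1, 0) : (Fin (K + 1) → ℝ) × ℝ)) +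
        t • ((0, 1) : (Fin (K + 1) → ℝ) × ℝ) := by
      refine Prod.ext ?_ ?_
      · ext j
        simp [Prod.fst_sum, Finset.sum_apply, Pi.single_apply]
      · simp [Prod.snd_sum]
    rw [h]
    simp only [map_add, map_sum, map_smul, smul_eq_mul, mul_comm, hc, hd]
  have hsep : ∀ x ∈ Set.Icc a b, ∀ y ∈ Set.Icc a b,
      L (φ x) - L (φ y) < d * (2 * EK K a b f) := by
    intro x hx y hy
    have h₁ := hlt _ (Set.sub_mem_sub (subset_convexHull ℝ _ ⟨x, hx, rfl⟩)
      (subset_convexHull ℝ _ ⟨y, hy, rfl⟩))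
    rw [map_sub] at h₁
    rw [hL] at hu
    simp only [Pi.zero_apply, mul_zero, Finset.sum_const_zero, zero_add] at hu
    exact h₁.trans hu
  have hE := EK_nonneg K a b f
  have hdpos : 0 < d := by
    have h := hsep a ⟨le_rfl, hab⟩ a ⟨le_rfl, hab⟩
    rw [sub_self] at h
    exact pos_of_mul_pos_left h (by linarith)
  refine lt_irrefl (2 * EK K a b f)
    (two_mul_EK_lt_of_forall_sub_lt hab hf (fun i => -(c i / d)) fun x hx y hy => ?_)
  have hdiv : ∀ x : ℝ, f x - ∑ i : Fin (K + 1), -(c i / d) * x ^ (i : ℕ) = L (φ x) / d := by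
    intro x
    rw [hφdef, hL, add_div, mul_div_cancel_left₀ _ hdpos.ne', Finset.sum_div,
      sub_eq_add_neg, ← Finset.sum_neg_distrib, add_comm]
    congr 1
    exact Finset.sum_congr rfl fun i _ => by ring
  rw [hdiv, hdiv, ← sub_div, div_lt_iff₀ hdpos, mul_comm _ d]
  exact hsep x hx y hy

theorem stmt16 (a b : ℝ) (ha : 0 < a) (hab : a ≤ b) (K : ℕ) (hK : 0 < K)
    (f : ℝ → ℝ) (hf : ContinuousOn f (Set.Icc a b)) :
    (∃ ν₀ ν₁ : Measure ℝ, IsProbabilityMeasure ν₀ ∧ IsProbabilityMeasure ν₁ ∧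
      ν₀ (Set.Icc a b)ᶜ = 0 ∧ ν₁ (Set.Icc a b)ᶜ = 0 ∧
      (∀ l : ℕ, l ≤ K →
        (∫ t in Set.Icc a b, t ^ l ∂ν₁) = ∫ t in Set.Icc a b, t ^ l ∂ν₀) ∧
      (∫ t in Set.Icc a b, f t ∂ν₁) - (∫ t in Set.Icc a b, f t ∂ν₀) = 2 * EK K a b f) ∧
    ∀ ν₀ ν₁ : Measure ℝ, IsProbabilityMeasure ν₀ → IsProbabilityMeasure ν₁ →
      ν₀ (Set.Icc a b)ᶜ = 0 → ν₁ (Set.Icc a b)ᶜ = 0 →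
      (∀ l : ℕ, l ≤ K →
        (∫ t in Set.Icc a b, t ^ l ∂ν₁) = ∫ t in Set.Icc a b, t ^ l ∂ν₀) →
      (∫ t in Set.Icc a b, f t ∂ν₁) - (∫ t in Set.Icc a b, f t ∂ν₀) ≤ 2 * EK K a b f := by
  refine ⟨?_, fun ν₀ ν₁ _ _ _ _ hmom => integral_sub_integral_le_two_mul_EK hf hmom⟩
  obtain ⟨z₁, hz₁, z₀, hz₀, hz⟩ := zero_two_mul_EK_mem_convexHull_sub (K := K) hab hf
  have hφ : ContinuousOn (fun x => ((fun i : Fin (K + 1) => x ^ (i : ℕ)), f x)) (Set.Icc a b) :=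
    ContinuousOn.prodMk (by fun_prop) hf
  obtain ⟨ν₁, hν₁, hs₁, rfl⟩ :=
    exists_isProbabilityMeasure_integral_eq_of_mem_convexHull isCompact_Icc hφ hz₁
  obtain ⟨ν₀, hν₀, hs₀, rfl⟩ :=
    exists_isProbabilityMeasure_integral_eq_of_mem_convexHull isCompact_Icc hφ hz₀
  have hφ₁ := hφ.integrableOn_compact (μ := ν₁) isCompact_Icc
  have hφ₀ := hφ.integrableOn_compact (μ := ν₀) isCompact_Icc
  refine ⟨ν₀, ν₁, hν₀, hν₁, hs₀, hs₁, fun l hl => ?_, ?_⟩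
  · let P : (Fin (K + 1) → ℝ) × ℝ →L[ℝ] ℝ :=
      (ContinuousLinearMap.proj (R := ℝ) (φ := fun _ : Fin (K + 1) => ℝ)
        ⟨l, Nat.lt_succ_iff.2 hl⟩).comp (ContinuousLinearMap.fst ℝ _ _)
    have h := congrArg P hz
    rw [map_sub, ← P.integral_comp_comm hφ₁, ← P.integral_comp_comm hφ₀] at h
    exact sub_eq_zero.1 h
  · let P : (Fin (K + 1) → ℝ) × ℝ →L[ℝ] ℝ := ContinuousLinearMap.snd ℝ _ _
    have h := congrArg P hz
    rw [map_sub, ← P.integral_comp_comm hφ₁, ← P.integral_comp_comm hφ₀] at h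
    exact h
end

section
/- For every ε > 0 there exists a constant C₀ > 0 such that for all integers S ≥ 1 and n ≥ 2 there exists an estimator Ĥ (a measurable real-valued function of n i.i.d. samples from P) satisfying sup over P in the probability simplex M_S of E_P | Ĥ − H(P) | ≤ C₀ ( S/(n ln n) + n^ε · min( √(S/n), n^{−1/3} ) ), where H(P) = Σ_{i=1}^S p_i ln(1/p_i) is the Shannon entropy (with the convention 0·ln(1/0) = 0). -/
/-- The probability simplex M_S. -/
def simplex (S : ℕ) : Set (Fin S → ℝ) := {P | (∀ i, 0 ≤ P i) ∧ ∑ i, P i = 1}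

/-- Expectation of `f` over `n` i.i.d. samples from the discrete distribution `P`. -/
noncomputable def iidExp {S n : ℕ} (P : Fin S → ℝ) (f : (Fin n → Fin S) → ℝ) : ℝ :=
  ∑ x : Fin n → Fin S, (∏ m, P (x m)) * f x

/-- The Shannon entropy `H(P) = Σ p_i ln(1/p_i)` (with the convention `0 · ln(1/0) = 0`). -/
noncomputable def shannonEntropy {S : ℕ} (P : Fin S → ℝ) : ℝ := ∑ i, -(P i * Real.log (P i))

/-- Expectation of `g N` for a binomial variable `N` with parameters `n` and `p`. -/
noncomputable def binomExp : ℕ → (ℕ → ℝ) → ℝ → ℝ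
  | 0, g, _ => g 0
  | n + 1, g, p => p * binomExp n (fun k => g (k + 1)) p + (1 - p) * binomExp n g p

namespace binomExp

lemma add (n : ℕ) (g h : ℕ → ℝ) (p : ℝ) :
    binomExp n (fun k => g k + h k) p = binomExp n g p + binomExp n h p := by
  induction n generalizing g h with
  | zero => rfl
  | succ n ih => simp only [binomExp, ih]; ring

lemma const_mul (n : ℕ) (c : ℝ) (g : ℕ → ℝ) (p : ℝ) :
    binomExp n (fun k => c * g k) p = c * binomExp n g p := by
  induction n generalizing g with
  | zero => rfl
  | succ n ih => simp only [binomExp, ih]; ring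

lemma sub (n : ℕ) (g h : ℕ → ℝ) (p : ℝ) :
    binomExp n (fun k => g k - h k) p = binomExp n g p - binomExp n h p := by
  induction n generalizing g h with
  | zero => rfl
  | succ n ih => simp only [binomExp, ih]; ring

lemma const (n : ℕ) (c p : ℝ) : binomExp n (fun _ => c) p = c := by
  induction n with
  | zero => rfl
  | succ n ih => simp only [binomExp, ih]; ring

lemma congr {n : ℕ} {g h : ℕ → ℝ} (H : ∀ k ≤ n, g k = h k) (p : ℝ) :
    binomExp n g p = binomExp n h p := by
  induction n generalizing g h with
  | zero => exact H 0 le_rfl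
  | succ n ih =>
    simp only [binomExp]
    rw [ih (fun k hk => H k (by omega)),
      ih (g := fun k => g (k + 1)) (h := fun k => h (k + 1)) (fun k hk => H (k + 1) (by omega))]

lemma at_one (n : ℕ) (g : ℕ → ℝ) : binomExp n g 1 = g n := by
  induction n generalizing g with
  | zero => rfl
  | succ n ih => simp only [binomExp, ih]; ring

/-- Size biasing: `E[N g(N - 1)] = (n + 1) p E[g(N')]` with one trial fewer on the right. -/
lemma size_bias (n : ℕ) (g : ℕ → ℝ) (p : ℝ) :
    binomExp (n + 1) (fun k => (k : ℝ) * g (k - 1)) p = (n + 1) * p * binomExp n g p := by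
  induction n generalizing g with
  | zero => simp [binomExp]
  | succ n ih =>
    rw [binomExp]
    have h : binomExp (n + 1) (fun k => ((k + 1 : ℕ) : ℝ) * g (k + 1 - 1)) p =
        binomExp (n + 1) (fun k => (k : ℝ) * (fun j => g (j + 1)) (k - 1)) p +
          binomExp (n + 1) g p := by
      rw [← add]
      congr 1
      funext k
      rcases k with _ | k
      · simp
      · simp only [Nat.add_sub_cancel]; push_cast; ring
    rw [h, ih fun j => g (j + 1), ih]
    push_cast
    simp only [binomExp]
    ring

lemma hasDerivAt (n : ℕ) (g : ℕ → ℝ) (p : ℝ) :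
    HasDerivAt (binomExp (n + 1) g)
      ((n + 1) * binomExp n (fun k => g (k + 1) - g k) p) p := by
  induction n generalizing g with
  | zero =>
    have h : HasDerivAt (fun q : ℝ => q * g 1 + (1 - q) * g 0) (1 * g 1 + -1 * g 0) p :=
      ((hasDerivAt_id p).mul_const (g 1)).add
        (((hasDerivAt_id p).const_sub 1).mul_const (g 0))
    refine h.congr_deriv ?_
    simp [binomExp]; ring
  | succ n ih =>
    have hd : HasDerivAt (fun q : ℝ => q * binomExp (n + 1) (fun k => g (k + 1)) q +
        (1 - q) * binomExp (n + 1) g q) _ p :=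
      ((hasDerivAt_id p).mul (ih (fun k => g (k + 1)))).add
        (((hasDerivAt_id p).const_sub 1).mul (ih g))
    refine hd.congr_deriv ?_
    have h : binomExp (n + 1) (fun k => g (k + 1) - g k) p =
      binomExp (n + 1) (fun k => g (k + 1)) p - binomExp (n + 1) g p := sub _ _ _ _
    have h' : binomExp (n + 1) (fun k => g (k + 1) - g k) p =
      p * binomExp n (fun k => g (k + 1 + 1) - g (k + 1)) p +
        (1 - p) * binomExp n (fun k => g (k + 1) - g k) p := rfl
    simp only [id]
    push_cast
    linear_combination -h - (n + 1 : ℝ) * h'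

/-- The binomial point probabilities. -/
lemma ite_eq (m i : ℕ) (p : ℝ) :
    binomExp (m + i) (fun k => if k = i then 1 else 0) p =
      (m + i).choose i * p ^ i * (1 - p) ^ m := by
  induction i with
  | zero =>
    simp only [add_zero, Nat.choose_zero_right, Nat.cast_one, pow_zero, one_mul]
    induction m with
    | zero => simp [binomExp]
    | succ m ih =>
      rw [binomExp, ih, pow_succ]
      simp [const]
      ring
  | succ i ih =>
    have h := size_bias (m + i) (fun k => if k = i then 1 else 0) p
    have h2 : (fun k : ℕ => (k : ℝ) * (if k - 1 = i then (1 : ℝ) else 0)) =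
        fun k : ℕ => ((i : ℝ) + 1) * (if k = i + 1 then 1 else 0) := by
      funext k
      rcases k with _ | k
      · simp
      · by_cases hk : k = i <;> simp [hk]
    rw [h2, const_mul, ih] at h
    have h3 := Nat.add_one_mul_choose_eq (m + i) i
    have h3' : ((m + i : ℕ) + 1 : ℝ) * (m + i).choose i =
      (m + i + 1).choose (i + 1) * ((i : ℝ) + 1) := by exact_mod_cast h3
    have hi : ((i : ℝ) + 1) ≠ 0 := by positivity
    apply mul_left_cancel₀ hi
    rw [← add_assoc, h, pow_succ]
    linear_combination p * p ^ i * (1 - p) ^ m * h3'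

end binomExp

/-- Conditioning on the first sample. -/
lemma iidExp_succ {S n : ℕ} (P : Fin S → ℝ) (F : (Fin (n + 1) → Fin S) → ℝ) :
    iidExp P F = ∑ a, P a * iidExp P (fun x : Fin n → Fin S => F (Fin.cons a x)) := by
  unfold iidExp
  rw [← (Fin.consEquiv (fun _ : Fin (n + 1) => Fin S)).sum_comp, Fintype.sum_prod_type]
  refine Finset.sum_congr rfl fun a _ => ?_
  rw [Finset.mul_sum]
  refine Finset.sum_congr rfl fun x _ => ?_
  simp [Fin.consEquiv, Fin.prod_univ_succ, mul_assoc]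

lemma iidExp_add {S n : ℕ} (P : Fin S → ℝ) (F G : (Fin n → Fin S) → ℝ) :
    iidExp P (fun x => F x + G x) = iidExp P F + iidExp P G := by
  simp [iidExp, mul_add, Finset.sum_add_distrib]

lemma iidExp_const_mul {S n : ℕ} (P : Fin S → ℝ) (c : ℝ) (F : (Fin n → Fin S) → ℝ) :
    iidExp P (fun x => c * F x) = c * iidExp P F := by
  simp only [iidExp, Finset.mul_sum]
  exact Finset.sum_congr rfl fun x _ => by ring

lemma iidExp_sum {S n : ℕ} {ι : Type*} (s : Finset ι) (P : Fin S → ℝ)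
    (F : ι → (Fin n → Fin S) → ℝ) :
    iidExp P (fun x => ∑ i ∈ s, F i x) = ∑ i ∈ s, iidExp P (F i) := by
  simp only [iidExp, Finset.mul_sum]
  exact Finset.sum_comm

lemma iidExp_mono {S n : ℕ} {P : Fin S → ℝ} (hP : P ∈ simplex S) {F G : (Fin n → Fin S) → ℝ}
    (h : ∀ x, F x ≤ G x) : iidExp P F ≤ iidExp P G :=
  Finset.sum_le_sum fun x _ =>
    mul_le_mul_of_nonneg_left (h x) (Finset.prod_nonneg fun _ _ => hP.1 _)

lemma iidExp_const {S n : ℕ} {P : Fin S → ℝ} (hP : P ∈ simplex S) (c : ℝ) :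
    iidExp P (fun _ : Fin n → Fin S => c) = c := by
  induction n with
  | zero => simp [iidExp]
  | succ n ih => rw [iidExp_succ]; simp only [ih]; rw [← Finset.sum_mul, hP.2, one_mul]

/-- Changing one sample changes the statistic by at most `c`. -/
def BoundedDiff {S n : ℕ} (F : (Fin n → Fin S) → ℝ) (c : ℝ) : Prop :=
  ∀ x i a, |F (Function.update x i a) - F x| ≤ c

/-- The Efron–Stein inequality for statistics with bounded differences. -/
lemma BoundedDiff.variance_le {S n : ℕ} {P : Fin S → ℝ} (hP : P ∈ simplex S)
    {F : (Fin n → Fin S) → ℝ} {c : ℝ} (hF : BoundedDiff F c) :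
    iidExp P (fun x => (F x - iidExp P F) ^ 2) ≤ n * c ^ 2 := by
  induction n with
  | zero => simp [iidExp]
  | succ n ih =>
    set μ : Fin S → ℝ := fun a => iidExp P (fun x : Fin n → Fin S => F (Fin.cons a x)) with hμ
    have hmean : iidExp P F = ∑ b, P b * μ b := iidExp_succ P F
    have hdiff : ∀ a b, |μ a - μ b| ≤ c := by
      intro a b
      have key : ∀ a b, μ a ≤ μ b + c := by
        intro a b
        have h1 : iidExp P (fun x : Fin n → Fin S => F (Fin.cons b x) + c) = μ b + c := by
          rw [iidExp_add, iidExp_const hP]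
        rw [← h1]
        refine iidExp_mono hP fun x => ?_
        have := (abs_le.1 (hF (Fin.cons b x) 0 a)).2
        rw [Fin.update_cons_zero] at this
        linarith
      exact abs_le.2 ⟨by linarith [key b a], by linarith [key a b]⟩
    have hdev : ∀ a, (μ a - iidExp P F) ^ 2 ≤ c ^ 2 := by
      intro a
      have h1 : μ a - iidExp P F = ∑ b, P b * (μ a - μ b) := by
        simp only [mul_sub, Finset.sum_sub_distrib, ← Finset.sum_mul, hP.2, hmean, one_mul]
      have h2 : |μ a - iidExp P F| ≤ c := by
        rw [h1]
        calc |∑ b, P b * (μ a - μ b)| ≤ ∑ b, |P b * (μ a - μ b)| :=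
              Finset.abs_sum_le_sum_abs _ _
          _ ≤ ∑ b, P b * c := Finset.sum_le_sum fun b _ => by
              rw [abs_mul, abs_of_nonneg (hP.1 b)]
              exact mul_le_mul_of_nonneg_left (hdiff a b) (hP.1 b)
          _ = c := by rw [← Finset.sum_mul, hP.2, one_mul]
      exact sq_le_sq' (by linarith [(abs_le.1 h2).1]) (abs_le.1 h2).2
    rw [iidExp_succ]
    have hstep : ∀ a, iidExp P (fun x : Fin n → Fin S => (F (Fin.cons a x) - iidExp P F) ^ 2) ≤
        n * c ^ 2 + c ^ 2 := by
      intro a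
      have hfun : (fun x : Fin n → Fin S => (F (Fin.cons a x) - iidExp P F) ^ 2) = fun x =>
          (F (Fin.cons a x) - μ a) ^ 2 + ((2 * (μ a - iidExp P F)) * F (Fin.cons a x) +
            ((μ a - iidExp P F) ^ 2 - 2 * (μ a - iidExp P F) * μ a)) := by
        funext x; ring
      have hBD : BoundedDiff (fun x : Fin n → Fin S => F (Fin.cons a x)) c := by
        intro x i b
        have := hF (Fin.cons a x) i.succ b
        rwa [← Fin.cons_update] at this
      have hvar := ih hBD
      rw [hfun, iidExp_add, iidExp_add, iidExp_const_mul, iidExp_const hP]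
      have hd := hdev a
      have : iidExp P (fun x : Fin n → Fin S => F (Fin.cons a x)) = μ a := rfl
      rw [this] at hvar ⊢
      nlinarith
    calc ∑ a, P a * iidExp P (fun x : Fin n → Fin S => (F (Fin.cons a x) - iidExp P F) ^ 2)
        ≤ ∑ a, P a * (n * c ^ 2 + c ^ 2) :=
          Finset.sum_le_sum fun a _ => mul_le_mul_of_nonneg_left (hstep a) (hP.1 a)
      _ = ((n + 1 : ℕ) : ℝ) * c ^ 2 := by
          rw [← Finset.sum_mul, hP.2]; push_cast; ring

lemma BoundedDiff.mean_abs_sub_le {S n : ℕ} {P : Fin S → ℝ} (hP : P ∈ simplex S)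
    {F : (Fin n → Fin S) → ℝ} {c : ℝ} (hc : 0 < c) (hn : 0 < n) (hF : BoundedDiff F c) :
    iidExp P (fun x => |F x - iidExp P F|) ≤ c * √n := by
  set s := c * √n with hs
  have hs0 : 0 < s := by positivity
  have hs2 : s ^ 2 = n * c ^ 2 := by rw [hs, mul_pow, Real.sq_sqrt (by positivity)]; ring
  calc iidExp P (fun x => |F x - iidExp P F|)
      ≤ iidExp P (fun x => (1 / (2 * s)) * (F x - iidExp P F) ^ 2 + s / 2) := by
        refine iidExp_mono hP fun x => ?_
        rw [← sq_abs (F x - iidExp P F)]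
        have : (1 / (2 * s)) * |F x - iidExp P F| ^ 2 + s / 2 - |F x - iidExp P F| =
            (|F x - iidExp P F| - s) ^ 2 / (2 * s) := by field_simp; ring
        have h2 : 0 ≤ (|F x - iidExp P F| - s) ^ 2 / (2 * s) := by positivity
        linarith
    _ = (1 / (2 * s)) * iidExp P (fun x => (F x - iidExp P F) ^ 2) + s / 2 := by
        rw [iidExp_add, iidExp_const_mul, iidExp_const hP]
    _ ≤ (1 / (2 * s)) * s ^ 2 + s / 2 := by
        rw [hs2]
        gcongr
        exact hF.variance_le hP
    _ = s := by field_simp; ring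

/-- `q P` has an unbiased estimator from `n` samples with differences bounded by `c`. -/
def HasUnbiased (S n : ℕ) (q : (Fin S → ℝ) → ℝ) (c : ℝ) : Prop :=
  ∃ F : (Fin n → Fin S) → ℝ, BoundedDiff F c ∧ ∀ P ∈ simplex S, iidExp P F = q P

namespace HasUnbiased

variable {S n : ℕ} {q r : (Fin S → ℝ) → ℝ} {c d : ℝ}

lemma add (hq : HasUnbiased S n q c) (hr : HasUnbiased S n r d) :
    HasUnbiased S n (fun P => q P + r P) (c + d) := by
  obtain ⟨F, hF, hFq⟩ := hq
  obtain ⟨G, hG, hGr⟩ := hr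
  refine ⟨fun x => F x + G x, fun x i a => ?_, fun P hP => ?_⟩
  · calc |F (Function.update x i a) + G (Function.update x i a) - (F x + G x)|
        = |(F (Function.update x i a) - F x) + (G (Function.update x i a) - G x)| := by
          congr 1; ring
      _ ≤ c + d := (abs_add_le _ _).trans (add_le_add (hF x i a) (hG x i a))
  · rw [iidExp_add, hFq P hP, hGr P hP]

lemma zero : HasUnbiased S n (fun _ => 0) 0 :=
  ⟨fun _ => 0, fun _ _ _ => by simp, fun P _ => by simp [iidExp]⟩

lemma sum {ι : Type*} (s : Finset ι) (q : ι → (Fin S → ℝ) → ℝ) (c : ι → ℝ)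
    (h : ∀ i ∈ s, HasUnbiased S n (q i) (c i)) :
    HasUnbiased S n (fun P => ∑ i ∈ s, q i P) (∑ i ∈ s, c i) := by
  classical
  induction s using Finset.induction_on with
  | empty => simpa using zero
  | insert a s ha ih =>
    simp only [Finset.sum_insert ha]
    exact (h a (Finset.mem_insert_self a s)).add
      (ih fun i hi => h i (Finset.mem_insert_of_mem hi))

lemma succ (hc : 0 ≤ c) (hq : HasUnbiased S n q c) : HasUnbiased S (n + 1) q c := by
  obtain ⟨F, hF, hFq⟩ := hq
  refine ⟨fun x => F (Fin.tail x), fun x i a => ?_, fun P hP => ?_⟩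
  · refine Fin.cases ?_ (fun j => ?_) i
    · simpa using hc
    · simpa using hF (Fin.tail x) j a
  · rw [iidExp_succ]
    simp only [Fin.tail_cons, hFq P hP, ← Finset.sum_mul, hP.2, one_mul]

lemma mono_left {N : ℕ} (hc : 0 ≤ c) (hnN : n ≤ N) (hq : HasUnbiased S n q c) :
    HasUnbiased S N q c := by
  induction N, hnN using Nat.le_induction with
  | base => exact hq
  | succ N _ ih => exact ih.succ hc

end HasUnbiased

/-- The number of occurrences of the symbol `s`. -/
def symbolCount {S n : ℕ} (x : Fin n → Fin S) (s : Fin S) : ℕ := ∑ t, if x t = s then 1 else 0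

lemma symbolCount_cons {S n : ℕ} (a : Fin S) (x : Fin n → Fin S) (s : Fin S) :
    symbolCount (Fin.cons a x : Fin (n + 1) → Fin S) s =
      symbolCount x s + if a = s then 1 else 0 := by
  rw [symbolCount, Fin.sum_univ_succ, add_comm]
  simp only [Fin.cons_succ, Fin.cons_zero, symbolCount]

lemma iidExp_symbolCount {S n : ℕ} {P : Fin S → ℝ} (hP : P ∈ simplex S) (g : ℕ → ℝ) (s : Fin S) :
    iidExp P (fun x : Fin n → Fin S => g (symbolCount x s)) = binomExp n g (P s) := by
  induction n generalizing g with
  | zero => simp [iidExp, symbolCount, binomExp]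
  | succ n ih =>
    rw [iidExp_succ, binomExp, ← ih g, ← ih fun k => g (k + 1)]
    have h1 : ∀ a, iidExp P (fun x : Fin n → Fin S => g (symbolCount (Fin.cons a x) s)) =
        iidExp P (fun x : Fin n → Fin S => g (symbolCount x s)) + if a = s then
          (iidExp P (fun x : Fin n → Fin S => g (symbolCount x s + 1)) -
            iidExp P (fun x : Fin n → Fin S => g (symbolCount x s))) else 0 := by
      intro a
      by_cases h : a = s <;> simp [symbolCount_cons, h]
    simp only [h1, mul_add, Finset.sum_add_distrib, ← Finset.sum_mul, hP.2, mul_ite, mul_zero,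
      Finset.sum_ite_eq', Finset.mem_univ, if_true]
    ring

lemma symbolCount_update {S n : ℕ} (x : Fin n → Fin S) (i : Fin n) (a s : Fin S) :
    symbolCount (Function.update x i a) s + (if x i = s then 1 else 0) =
      symbolCount x s + if a = s then 1 else 0 := by
  unfold symbolCount
  rw [← Finset.add_sum_erase _ _ (Finset.mem_univ i),
    ← Finset.add_sum_erase (a := i) _ (fun t => if x t = s then 1 else 0) (Finset.mem_univ i)]
  have : ∑ t ∈ Finset.univ.erase i, (if Function.update x i a t = s then 1 else 0) =
      ∑ t ∈ Finset.univ.erase i, if x t = s then 1 else 0 :=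
    Finset.sum_congr rfl fun t ht => by rw [Function.update_of_ne (Finset.ne_of_mem_erase ht)]
  rw [this, Function.update_self]
  ring

lemma boundedDiff_sum_symbolCount {S n : ℕ} {g : ℕ → ℝ} {c : ℝ}
    (hg : ∀ k, |g (k + 1) - g k| ≤ c) :
    BoundedDiff (fun x : Fin n → Fin S => ∑ s, g (symbolCount x s)) (2 * c) := by
  intro x i a
  have hc : 0 ≤ c := (abs_nonneg _).trans (hg 0)
  rw [← Finset.sum_sub_distrib]
  calc |∑ s, (g (symbolCount (Function.update x i a) s) - g (symbolCount x s))|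
      ≤ ∑ s, |g (symbolCount (Function.update x i a) s) - g (symbolCount x s)| :=
        Finset.abs_sum_le_sum_abs _ _
    _ ≤ ∑ s, ((if x i = s then c else 0) + if a = s then c else 0) := by
        refine Finset.sum_le_sum fun s _ => ?_
        have h := symbolCount_update x i a s
        by_cases h1 : x i = s <;> by_cases h2 : a = s <;> simp only [h1, h2, if_true, if_false] at h ⊢
        · rw [Nat.add_right_cancel h]; simpa using hc
        · have h' : symbolCount x s = symbolCount (Function.update x i a) s + 1 := h.symm
          rw [h', abs_sub_comm]; simpa using hg _
        · rw [show symbolCount (Function.update x i s) s = symbolCount x s + 1 from h]; simpa using hg _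
        · have h' : symbolCount (Function.update x i a) s = symbolCount x s := h
          rw [h']; simp
    _ = 2 * c := by
        simp [Finset.sum_add_distrib]; ring

/-- Size-biased counts estimate `∑ p_s E[h(N_s)]` without bias. -/
lemma hasUnbiased_sum_mul_binomExp (S M : ℕ) {h : ℕ → ℝ} {c : ℝ}
    (hh : ∀ k : ℕ, |((k : ℝ) + 1) * h k - k * h (k - 1)| ≤ c * (M + 1)) :
    HasUnbiased S (M + 1) (fun P => ∑ s, P s * binomExp M h (P s)) (2 * c) := by
  have hM : (0 : ℝ) < M + 1 := by positivity
  set g : ℕ → ℝ := fun k => 1 / ((M : ℝ) + 1) * ((k : ℝ) * h (k - 1)) with hg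
  have hgc : ∀ k, |g (k + 1) - g k| ≤ c := by
    intro k
    have : g (k + 1) - g k = (((k : ℝ) + 1) * h k - k * h (k - 1)) / (M + 1) := by
      simp only [hg, Nat.add_sub_cancel]; push_cast; ring
    rw [this, abs_div, abs_of_pos hM, div_le_iff₀ hM]
    exact hh k
  refine ⟨_, boundedDiff_sum_symbolCount hgc, fun P hP => ?_⟩
  rw [iidExp_sum]
  refine Finset.sum_congr rfl fun s _ => ?_
  rw [iidExp_symbolCount hP, hg, binomExp.const_mul, binomExp.size_bias]
  field_simp

lemma nine_le_exp_three : (9 : ℝ) ≤ Real.exp 3 := by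
  have e : Real.exp 3 = Real.exp 1 ^ 3 := by rw [← Real.exp_nat_mul]; norm_num
  have : (2.7 : ℝ) ^ 3 ≤ Real.exp 1 ^ 3 :=
    pow_le_pow_left₀ (by norm_num) (by linarith [Real.exp_one_gt_d9]) 3
  rw [e]
  norm_num at this
  linarith

open Polynomial in
/-- The polynomials with `V_k (sin² θ) = sin² (k θ) / sin² θ`. -/
noncomputable def fejerPoly : ℕ → ℝ[X]
  | 0 => 0
  | 1 => 1
  | k + 2 => C 2 * fejerPoly (k + 1) - C 4 * (X * fejerPoly (k + 1)) - fejerPoly k + C 2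

namespace fejerPoly

open Polynomial

lemma eval_succ_succ (k : ℕ) (x : ℝ) : (fejerPoly (k + 2)).eval x =
    2 * (1 - 2 * x) * (fejerPoly (k + 1)).eval x - (fejerPoly k).eval x + 2 := by
  simp only [fejerPoly, eval_add, eval_sub, eval_mul, eval_C, eval_X]
  ring

lemma coeff_zero (k : ℕ) : (fejerPoly k).coeff 0 = (k : ℝ) ^ 2 := by
  induction k using Nat.twoStepInduction with
  | zero => simp [fejerPoly]
  | one => simp [fejerPoly]
  | more k h1 h2 =>
    simp only [fejerPoly, coeff_add, coeff_sub, coeff_C_zero, h1, h2,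
      mul_coeff_zero, coeff_X_zero]
    push_cast
    ring

lemma coeff_succ (k i : ℕ) : (fejerPoly (k + 2)).coeff (i + 1) =
    2 * (fejerPoly (k + 1)).coeff (i + 1) - 4 * (fejerPoly (k + 1)).coeff i -
      (fejerPoly k).coeff (i + 1) := by
  simp [fejerPoly]

lemma coeff_eq_zero {k i : ℕ} (h : k ≤ i) (hi : 0 < i) : (fejerPoly k).coeff i = 0 := by
  induction k using Nat.twoStepInduction generalizing i with
  | zero => simp [fejerPoly]
  | one => simp [fejerPoly, coeff_one, hi.ne']
  | more k h1 h2 =>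
    obtain ⟨j, rfl⟩ : ∃ j, i = j + 1 := ⟨i - 1, by omega⟩
    rw [coeff_succ, h2 (by omega) hi, h2 (by omega) (by omega), h1 (by omega) hi]
    ring

lemma abs_coeff_le (k i : ℕ) : |(fejerPoly k).coeff i| ≤ 9 ^ k := by
  induction k using Nat.twoStepInduction generalizing i with
  | zero => simp [fejerPoly]
  | one =>
    simp only [fejerPoly, coeff_one]
    split_ifs <;> norm_num
  | more k h1 h2 =>
    have hk : (1 : ℝ) ≤ 9 ^ k := one_le_pow₀ (by norm_num)
    rcases i with _ | i
    · have a := abs_le.1 (h1 0)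
      have b := abs_le.1 (h2 0)
      simp only [fejerPoly, coeff_add, coeff_sub, coeff_C_zero,
        mul_coeff_zero, coeff_X_zero]
      rw [pow_succ] at b
      rw [pow_succ, pow_succ, abs_le]
      constructor <;> linarith
    · have a := abs_le.1 (h1 (i + 1))
      have b := abs_le.1 (h2 (i + 1))
      have c := abs_le.1 (h2 i)
      rw [coeff_succ]
      rw [pow_succ] at b c
      rw [pow_succ, pow_succ, abs_le]
      constructor <;> linarith

lemma eval_eq_sum {k : ℕ} (hk : 0 < k) (x : ℝ) :
    (fejerPoly k).eval x = ∑ i ∈ Finset.range k, (fejerPoly k).coeff i * x ^ i := by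
  refine eval_eq_sum_range' ?_ x
  rw [Nat.lt_iff_le_pred hk, natDegree_le_iff_coeff_eq_zero]
  intro i hi
  have : k ≤ i := Nat.le_of_pred_lt hi
  exact coeff_eq_zero this (by omega)

lemma sin_sq_mul_eval (k : ℕ) (θ : ℝ) :
    Real.sin θ ^ 2 * (fejerPoly k).eval (Real.sin θ ^ 2) = Real.sin (k * θ) ^ 2 := by
  induction k using Nat.twoStepInduction with
  | zero => simp [fejerPoly]
  | one => simp [fejerPoly]
  | more k h1 h2 =>
    rw [eval_succ_succ]
    have e1 : ((k + 2 : ℕ) : ℝ) * θ = (k + 1 : ℕ) * θ + θ := by push_cast; ring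
    have e2 : (k : ℝ) * θ = (k + 1 : ℕ) * θ - θ := by push_cast; ring
    rw [e2] at h1
    rw [e1, Real.sin_add]
    rw [Real.sin_sub] at h1
    have c1 := Real.sin_sq_add_cos_sq θ
    have c2 := Real.sin_sq_add_cos_sq (((k + 1 : ℕ) : ℝ) * θ)
    generalize Real.sin (((k + 1 : ℕ) : ℝ) * θ) = s at *
    generalize Real.cos (((k + 1 : ℕ) : ℝ) * θ) = c at *
    have c1' : Real.cos θ ^ 2 = 1 - Real.sin θ ^ 2 := by linarith
    have c2' : c ^ 2 = 1 - s ^ 2 := by linarith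
    linear_combination 2 * (1 - 2 * Real.sin θ ^ 2) * h2 - h1 - 2 * s ^ 2 * c1' -
      2 * Real.sin θ ^ 2 * c2'

lemma mul_abs_eval_le_one (k : ℕ) {x : ℝ} (h0 : 0 ≤ x) (h1 : x ≤ 1) :
    x * |(fejerPoly k).eval x| ≤ 1 := by
  have h := sin_sq_mul_eval k (Real.arcsin (√x))
  have hs : Real.sin (Real.arcsin (√x)) = √x :=
    Real.sin_arcsin (by linarith [Real.sqrt_nonneg x]) (Real.sqrt_le_one.2 h1)
  rw [hs, Real.sq_sqrt h0] at h
  have habs : x * |(fejerPoly k).eval x| = |x * (fejerPoly k).eval x| := by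
    rw [abs_mul, abs_of_nonneg h0]
  rw [habs, h, abs_of_nonneg (sq_nonneg _)]
  exact Real.sin_sq_le_one _

lemma mul_abs_eval_le_exp {k : ℕ} (hk : 0 < k) {x : ℝ} (hx : 1 ≤ x) :
    x * |(fejerPoly k).eval x| ≤ Real.exp (5 * k * x) := by
  have h1 : |(fejerPoly k).eval x| ≤ k * (9 ^ k * x ^ (k - 1)) := by
    rw [eval_eq_sum hk]
    calc |∑ i ∈ Finset.range k, (fejerPoly k).coeff i * x ^ i|
        ≤ ∑ i ∈ Finset.range k, |(fejerPoly k).coeff i * x ^ i| :=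
          Finset.abs_sum_le_sum_abs _ _
      _ ≤ ∑ i ∈ Finset.range k, 9 ^ k * x ^ (k - 1) := by
          refine Finset.sum_le_sum fun i hi => ?_
          rw [abs_mul, abs_of_nonneg (by positivity : 0 ≤ x ^ i)]
          have : i ≤ k - 1 := by have := Finset.mem_range.1 hi; omega
          exact mul_le_mul (abs_coeff_le k i) (pow_le_pow_right₀ hx this) (by positivity)
            (by positivity)
      _ = _ := by simp
  have hx0 : 0 < x := by linarith
  have hk' : (k : ℝ) ≤ Real.exp k := by linarith [Real.add_one_le_exp (k : ℝ)]
  have h9 : (9 : ℝ) ^ k ≤ Real.exp (3 * k) := by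
    rw [mul_comm, Real.exp_nat_mul]
    exact pow_le_pow_left₀ (by norm_num) nine_le_exp_three k
  have hxk : x ^ k ≤ Real.exp (k * x) := by
    rw [Real.exp_nat_mul]
    exact pow_le_pow_left₀ hx0.le (by linarith [Real.add_one_le_exp x]) k
  calc x * |(fejerPoly k).eval x| ≤ x * (k * (9 ^ k * x ^ (k - 1))) := by gcongr
    _ = k * 9 ^ k * x ^ k := by
        rw [show x ^ k = x ^ (k - 1) * x by rw [← pow_succ, Nat.sub_add_cancel hk]]; ring
    _ ≤ Real.exp k * Real.exp (3 * k) * Real.exp (k * x) := by gcongr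
    _ ≤ Real.exp (5 * k * x) := by
        rw [← Real.exp_add, ← Real.exp_add]
        refine Real.exp_le_exp.2 ?_
        have : (k : ℝ) * 1 ≤ k * x := by gcongr
        linarith

end fejerPoly

/-- The rescaled Fejér polynomial is dominated by `1 / y` after damping by `(1 - y) ^ m`. -/
lemma mul_damped_fejerPoly_le {m k : ℕ} (hm : 0 < m) (hk : 0 < k) {y : ℝ} (h0 : 0 ≤ y)
    (h1 : y ≤ 1) : y * ((1 - y) ^ m * |(fejerPoly k).eval (m / (5 * k) * y) / k ^ 2|) ≤
      5 / (m * k) := by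
  have hm' : (0 : ℝ) < m := by exact_mod_cast hm
  have hk' : (0 : ℝ) < k := by exact_mod_cast hk
  set x : ℝ := m / (5 * k) * y with hx
  have hx0 : 0 ≤ x := by positivity
  have hyx : y = 5 * k / m * x := by rw [hx]; field_simp
  have key : (1 - y) ^ m * (x * |(fejerPoly k).eval x|) ≤ 1 := by
    rcases le_total x 1 with hx1 | hx1
    · exact mul_le_one₀ (pow_le_one₀ (by linarith) (by linarith)) (by positivity)
        (fejerPoly.mul_abs_eval_le_one k hx0 hx1)
    · have h2 : (1 - y) ^ m ≤ Real.exp (-(5 * k * x)) := by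
        have : -(5 * k * x) = (m : ℝ) * (-y) := by rw [hyx]; field_simp
        rw [this, Real.exp_nat_mul]
        exact pow_le_pow_left₀ (by linarith) (Real.one_sub_le_exp_neg y) m
      calc (1 - y) ^ m * (x * |(fejerPoly k).eval x|)
          ≤ Real.exp (-(5 * k * x)) * Real.exp (5 * k * x) :=
            mul_le_mul h2 (fejerPoly.mul_abs_eval_le_exp hk hx1) (by positivity) (by positivity)
        _ = 1 := by rw [← Real.exp_add]; simp
  have : y * ((1 - y) ^ m * |(fejerPoly k).eval x / k ^ 2|) =
      5 / (m * k) * ((1 - y) ^ m * (x * |(fejerPoly k).eval x|)) := by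
    rw [abs_div, abs_of_pos (by positivity : (0 : ℝ) < (k : ℝ) ^ 2)]
    nth_rewrite 1 [hyx]
    field_simp
  rw [this]
  exact mul_le_of_le_one_right (by positivity) key

/-- A function vanishing at `1` with derivative of size `η / y²` is at most `η / p` at `p`. -/
lemma mul_abs_le_of_deriv_le {h h' : ℝ → ℝ} {η : ℝ} (hη : 0 ≤ η) (h1 : h 1 = 0)
    (hd : ∀ y, 0 < y → y ≤ 1 → HasDerivAt h (h' y) y)
    (hb : ∀ y, 0 < y → y ≤ 1 → |h' y| ≤ η / y ^ 2) {p : ℝ} (hp : 0 < p) (hp1 : p ≤ 1) :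
    p * |h p| ≤ η := by
  have key : ∀ σ : ℝ, |σ| = 1 → -(η / p) ≤ σ * h p := by
    intro σ hσ
    have hderiv : ∀ y ∈ Set.Icc p 1,
        HasDerivAt (fun y => σ * h y + η * y⁻¹) (σ * h' y + η * (-(y ^ 2)⁻¹)) y := by
      intro y hy
      have hy0 : 0 < y := hp.trans_le hy.1
      exact ((hd y hy0 hy.2).const_mul σ).add ((hasDerivAt_inv hy0.ne').const_mul η)
    have hanti : AntitoneOn (fun y => σ * h y + η * y⁻¹) (Set.Icc p 1) := by
      refine antitoneOn_of_deriv_nonpos (convex_Icc p 1)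
        (fun y hy => (hderiv y hy).continuousAt.continuousWithinAt)
        (fun y hy => (hderiv y (interior_subset hy)).differentiableAt.differentiableWithinAt)
        fun y hy => ?_
      have hy' := interior_subset hy
      rw [(hderiv y hy').deriv]
      have hle := hb y (hp.trans_le hy'.1) hy'.2
      have : σ * h' y ≤ |h' y| := (le_abs_self _).trans (by rw [abs_mul, hσ, one_mul])
      rw [div_eq_mul_inv] at hle
      linarith
    have := hanti (Set.left_mem_Icc.2 hp1) (Set.right_mem_Icc.2 hp1) hp1
    simp only [h1, inv_one, mul_zero, mul_one, zero_add] at this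
    rw [div_eq_mul_inv]
    linarith
  have a := key 1 (by simp)
  have b := key (-1) (by simp)
  have : |h p| ≤ η / p := abs_le.2 ⟨by linarith, by linarith⟩
  calc p * |h p| ≤ p * (η / p) := by gcongr
    _ = η := by field_simp

/-- Coefficients of the corrections to the truncated harmonic series in `logApprox`. -/
noncomputable def logCoeff (m k i : ℕ) : ℝ :=
  (fejerPoly k).coeff (i + 1) * ((m : ℝ) / (5 * k)) ^ (i + 1) / (k : ℝ) ^ 2 /
    ((i + 1) * (m + i + 1).choose (i + 1))

/-- A combination of binomial expectations approximating `p ↦ -log p`. -/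
noncomputable def logApprox (m k : ℕ) (p : ℝ) : ℝ :=
  binomExp m (fun j => ∑ l ∈ Finset.Ico j m, 1 / ((l : ℝ) + 1)) p -
    ∑ i ∈ Finset.range (k - 1),
      binomExp (m + i + 1) (fun j => if j ≤ i then logCoeff m k i else 0) p

lemma hasDerivAt_harmonic {m : ℕ} (hm : 0 < m) {y : ℝ} (hy : y ≠ 0) :
    HasDerivAt (binomExp m (fun j => ∑ l ∈ Finset.Ico j m, 1 / ((l : ℝ) + 1)))
      (-(1 - (1 - y) ^ m) / y) y := by
  obtain ⟨m, rfl⟩ : ∃ j, m = j + 1 := ⟨m - 1, by omega⟩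
  refine (binomExp.hasDerivAt m _ y).congr_deriv ?_
  have h1 : binomExp m (fun j => ∑ l ∈ Finset.Ico (j + 1) (m + 1), 1 / ((l : ℝ) + 1) -
      ∑ l ∈ Finset.Ico j (m + 1), 1 / ((l : ℝ) + 1)) y =
      binomExp m (fun j => -1 * (1 / ((j : ℝ) + 1))) y := by
    refine binomExp.congr (fun j hj => ?_) y
    rw [Finset.sum_eq_sum_Ico_succ_bot (show j < m + 1 by omega)]
    ring
  have h2 := binomExp.size_bias m (fun j => 1 / ((j : ℝ) + 1)) y
  have h3 : (fun j : ℕ => (j : ℝ) * (1 / (((j - 1 : ℕ) : ℝ) + 1))) =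
      fun j : ℕ => 1 - if j = 0 then 1 else 0 := by
    funext j
    rcases j with _ | j
    · simp
    · have : (j : ℝ) + 1 ≠ 0 := by positivity
      simp [this]
  have h4 := binomExp.ite_eq (m + 1) 0 y
  rw [h3, binomExp.sub (m + 1) (fun _ => 1), binomExp.const] at h2
  simp only [add_zero, Nat.choose_zero_right, Nat.cast_one, pow_zero, one_mul] at h4
  rw [h4] at h2
  rw [h1, binomExp.const_mul, eq_div_iff hy]
  linear_combination h2

lemma hasDerivAt_binomExp_le (M i : ℕ) (c y : ℝ) :
    HasDerivAt (binomExp (M + i + 1) (fun j => if j ≤ i then c else 0))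
      (-c * (M + i + 1) * ((M + i).choose i * y ^ i * (1 - y) ^ M)) y := by
  refine (binomExp.hasDerivAt (M + i) _ y).congr_deriv ?_
  have h : (fun j : ℕ => (if j + 1 ≤ i then c else 0) - if j ≤ i then c else 0) =
      fun j => -c * if j = i then 1 else 0 := by
    funext j
    rcases lt_trichotomy j i with h | h | h
    · simp [h.ne, h.le, Nat.succ_le_of_lt h]
    · simp [h]
    · have h1 : ¬ j ≤ i := by omega
      have h2 : ¬ j + 1 ≤ i := by omega
      simp [h.ne', h1, h2]
  rw [h, binomExp.const_mul, binomExp.ite_eq]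
  push_cast
  ring

lemma hasDerivAt_logApprox {m k : ℕ} (hm : 0 < m) (hk : 0 < k) {y : ℝ} (hy : y ≠ 0) :
    HasDerivAt (logApprox m k)
      ((-1 + (1 - y) ^ m * ((fejerPoly k).eval (m / (5 * k) * y) / (k : ℝ) ^ 2)) / y) y := by
  have h := (hasDerivAt_harmonic hm hy).sub (HasDerivAt.fun_sum (u := Finset.range (k - 1))
    fun i _ => hasDerivAt_binomExp_le m i (logCoeff m k i) y)
  refine HasDerivAt.congr_deriv (f := logApprox m k) h ?_
  have hk' : (k : ℝ) ≠ 0 := by positivity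
  obtain ⟨d, rfl⟩ : ∃ d, k = d + 1 := ⟨k - 1, by omega⟩
  have hterm : ∀ i, -logCoeff m (d + 1) i * (m + i + 1) *
      ((m + i).choose i * y ^ i * (1 - y) ^ m) =
      -((1 - y) ^ m * ((fejerPoly (d + 1)).coeff (i + 1) *
        ((m : ℝ) / (5 * (d + 1 : ℕ)) * y) ^ (i + 1) / ((d + 1 : ℕ) : ℝ) ^ 2) / y) := by
    intro i
    have h1 : ((m + i : ℕ) + 1 : ℝ) * (m + i).choose i =
      (m + i + 1).choose (i + 1) * ((i : ℝ) + 1) := by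
        exact_mod_cast Nat.add_one_mul_choose_eq (m + i) i
    have h2 : (((m + i + 1).choose (i + 1) : ℕ) : ℝ) ≠ 0 := by
      exact_mod_cast (Nat.choose_pos (by omega)).ne'
    have h3 : (i : ℝ) + 1 ≠ 0 := by positivity
    push_cast at h1
    unfold logCoeff
    rw [mul_pow, pow_succ y i]
    generalize ((m : ℝ) / (5 * (d + 1 : ℕ))) ^ (i + 1) = r
    generalize (fejerPoly (d + 1)).coeff (i + 1) = v
    generalize (1 - y) ^ m = q
    generalize y ^ i = z
    field_simp
    linear_combination -(v * r * z * q) * h1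
  rw [fejerPoly.eval_eq_sum hk, Finset.sum_range_succ', fejerPoly.coeff_zero]
  simp only [Nat.add_sub_cancel, hterm, Finset.sum_neg_distrib, ← Finset.sum_div, ← Finset.mul_sum]
  rw [pow_zero, mul_one]
  field_simp
  ring

lemma logApprox_one {m k : ℕ} : logApprox m k 1 = 0 := by
  simp [logApprox, binomExp.at_one]

lemma mul_abs_logApprox_add_log_le {m k : ℕ} (hm : 0 < m) (hk : 0 < k) {p : ℝ} (hp : 0 ≤ p)
    (hp1 : p ≤ 1) : p * |logApprox m k p + Real.log p| ≤ 5 / (m * k) := by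
  rcases hp.eq_or_lt with rfl | hp
  · simp; positivity
  refine mul_abs_le_of_deriv_le (h := fun y => logApprox m k y + Real.log y) (by positivity)
    (by simp [logApprox_one])
    (fun y hy _ => (hasDerivAt_logApprox hm hk hy.ne').add (Real.hasDerivAt_log hy.ne'))
    (fun y hy hy1 => ?_) hp hp1
  have h := mul_damped_fejerPoly_le hm hk hy.le hy1
  rw [le_div_iff₀ (by positivity)]
  refine le_trans (le_of_eq ?_) h
  have : (-1 + (1 - y) ^ m * ((fejerPoly k).eval (m / (5 * k) * y) / (k : ℝ) ^ 2)) / y + y⁻¹ =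
      (1 - y) ^ m * ((fejerPoly k).eval (m / (5 * k) * y) / (k : ℝ) ^ 2) / y := by
    field_simp; ring
  rw [this, abs_div, abs_mul, abs_of_pos hy, abs_of_nonneg (pow_nonneg (by linarith) m)]
  field_simp

lemma abs_logCoeff_mul_le {m k i : ℕ} (hi : i + 1 ≤ k) :
    |logCoeff m k i| * (i + 1) ≤ 9 ^ k / (k : ℝ) ^ 2 := by
  have hk' : (0 : ℝ) < k := by exact_mod_cast (by omega : 0 < k)
  have hch : (0 : ℝ) < (m + i + 1).choose (i + 1) := by
    exact_mod_cast Nat.choose_pos (by omega)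
  have hpow : ((m : ℝ) / (5 * k)) ^ (i + 1) ≤ (m + i + 1).choose (i + 1) := by
    have h1 : ((m : ℝ)) ^ (i + 1) ≤ (i + 1).factorial * (m + i + 1).choose (i + 1) := by
      have := Nat.pow_le_choose (α := ℝ) (i + 1) (m + i + 1)
      rw [show m + i + 1 + 1 - (i + 1) = m + 1 by omega] at this
      have h3 := (div_le_iff₀' (by positivity)).1 this
      refine le_trans (pow_le_pow_left₀ (by positivity) ?_ _) h3
      push_cast; linarith
    have h2 : ((i + 1).factorial : ℝ) ≤ (5 * k) ^ (i + 1) := by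
      have : ((i + 1).factorial : ℝ) ≤ ((i + 1 : ℕ) : ℝ) ^ (i + 1) := by
        exact_mod_cast Nat.factorial_le_pow (i + 1)
      refine this.trans (pow_le_pow_left₀ (by positivity) ?_ _)
      have : ((i + 1 : ℕ) : ℝ) ≤ k := by exact_mod_cast hi
      linarith
    rw [div_pow, div_le_iff₀ (by positivity)]
    calc (m : ℝ) ^ (i + 1) ≤ _ := h1
      _ ≤ (5 * k) ^ (i + 1) * (m + i + 1).choose (i + 1) := by gcongr
      _ = _ := mul_comm _ _
  unfold logCoeff
  rw [abs_div, abs_div, abs_mul, abs_of_pos (by positivity : (0 : ℝ) < (k : ℝ) ^ 2),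
    abs_of_nonneg (by positivity : (0 : ℝ) ≤ ((m : ℝ) / (5 * k)) ^ (i + 1)),
    abs_of_pos (by positivity : (0 : ℝ) < ((i : ℝ) + 1) * (m + i + 1).choose (i + 1))]
  calc |(fejerPoly k).coeff (i + 1)| * ((m : ℝ) / (5 * k)) ^ (i + 1) / (k : ℝ) ^ 2 /
        (((i : ℝ) + 1) * (m + i + 1).choose (i + 1)) * (i + 1)
      = |(fejerPoly k).coeff (i + 1)| / (k : ℝ) ^ 2 *
        (((m : ℝ) / (5 * k)) ^ (i + 1) / (m + i + 1).choose (i + 1)) := by field_simp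
    _ ≤ 9 ^ k / (k : ℝ) ^ 2 * 1 := by
        gcongr
        · exact fejerPoly.abs_coeff_le k (i + 1)
        · exact (div_le_one hch).2 hpow
    _ = _ := mul_one _

lemma HasUnbiased.harmonic (S : ℕ) {m : ℕ} (hm : 0 < m) :
    HasUnbiased S (m + 1) (fun P => ∑ s, P s *
      binomExp m (fun j => ∑ l ∈ Finset.Ico j m, 1 / ((l : ℝ) + 1)) (P s))
      (2 * ((1 + Real.log m) / m)) := by
  have hm' : (0 : ℝ) < m := by exact_mod_cast hm
  have hlog : 0 ≤ Real.log m := Real.log_natCast_nonneg m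
  refine hasUnbiased_sum_mul_binomExp S m fun j => ?_
  set G : ℕ → ℝ := fun j => ∑ l ∈ Finset.Ico j m, 1 / ((l : ℝ) + 1) with hG
  have hG0 : ∀ j, 0 ≤ G j := fun j => Finset.sum_nonneg fun l _ => by positivity
  have hG1 : ∀ j, G j ≤ 1 + Real.log m := by
    intro j
    have h1 : G j ≤ ∑ l ∈ Finset.range m, 1 / ((l : ℝ) + 1) := by
      refine Finset.sum_le_sum_of_subset_of_nonneg ?_ fun l _ _ => by positivity
      intro l hl
      exact Finset.mem_range.2 (Finset.mem_Ico.1 hl).2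
    have h2 := harmonic_le_one_add_log m
    rw [_root_.harmonic] at h2
    push_cast at h2
    exact h1.trans (by simpa [one_div] using h2)
  have hbig : 1 + Real.log m ≤ (1 + Real.log m) / m * (m + 1) := by
    have : (1 + Real.log m) / m * (m + 1) = 1 + Real.log m + (1 + Real.log m) / m := by
      field_simp
    rw [this]
    have : 0 ≤ (1 + Real.log m) / m := by positivity
    linarith
  refine le_trans ?_ hbig
  change |((j : ℝ) + 1) * G j - j * G (j - 1)| ≤ _
  rcases j with _ | j
  · simp only [Nat.cast_zero, zero_add, one_mul, zero_mul, sub_zero]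
    rw [abs_of_nonneg (hG0 0)]
    exact hG1 0
  · simp only [Nat.add_sub_cancel]
    push_cast
    rcases lt_or_ge j m with hj | hj
    · have hs : G j = 1 / ((j : ℝ) + 1) + G (j + 1) := Finset.sum_eq_sum_Ico_succ_bot hj _
      have : ((j : ℝ) + 1 + 1) * G (j + 1) - ((j : ℝ) + 1) * G j = G (j + 1) - 1 := by
        rw [hs]; field_simp; ring
      rw [this, abs_le]
      constructor <;> linarith [hG0 (j + 1), hG1 (j + 1)]
    · have h1 : G j = 0 := by simp [hG, Finset.Ico_eq_empty_of_le hj]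
      have h2 : G (j + 1) = 0 := by simp [hG, Finset.Ico_eq_empty_of_le (by omega : m ≤ j + 1)]
      rw [h1, h2]; simp; linarith

lemma HasUnbiased.binomExp_le (S : ℕ) {m : ℕ} (hm : 0 < m) (i : ℕ) {c b : ℝ}
    (hb : |c| * (i + 1) ≤ b) :
    HasUnbiased S (m + i + 1 + 1) (fun P => ∑ s, P s *
      binomExp (m + i + 1) (fun j => if j ≤ i then c else 0) (P s)) (2 * (b / m)) := by
  have hm' : (0 : ℝ) < m := by exact_mod_cast hm
  have hb0 : 0 ≤ b := le_trans (by positivity) hb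
  refine hasUnbiased_sum_mul_binomExp S (m + i + 1) fun j => ?_
  have hbig : b ≤ b / m * ((m + i + 1 : ℕ) + 1) := by
    have : b / m * ((m + i + 1 : ℕ) + 1) = b + b / m * (i + 2) := by
      push_cast; field_simp; ring
    rw [this]
    have : 0 ≤ b / m * (i + 2) := by positivity
    linarith
  refine le_trans (le_trans ?_ hb) hbig
  have hc1 : |c| ≤ |c| * (i + 1) := le_mul_of_one_le_right (abs_nonneg c) (by simp)
  rcases lt_trichotomy j (i + 1) with h | h | h
  · have h1 : j ≤ i := by omega
    have h2 : j - 1 ≤ i := by omega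
    simp only [h1, h2, if_true]
    rw [show ((j : ℝ) + 1) * c - j * c = c by ring]
    exact hc1
  · subst h
    simp only [Nat.add_sub_cancel, le_refl, if_true, Nat.succ_le_iff, lt_irrefl, if_false]
    rw [mul_zero, zero_sub, abs_neg, abs_mul, mul_comm]
    push_cast
    rw [abs_of_pos (by positivity : (0 : ℝ) < (i : ℝ) + 1)]
  · have h1 : ¬ j ≤ i := by omega
    have h2 : ¬ j - 1 ≤ i := by omega
    simp only [h1, h2, if_false]
    simp; positivity

lemma HasUnbiased.logApprox (S : ℕ) {m k : ℕ} (hm : 0 < m) (hk : 0 < k) :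
    HasUnbiased S (m + k) (fun P => ∑ s, P s * logApprox m k (P s))
      (2 * (1 + Real.log m + 9 ^ k) / m) := by
  have hm' : (0 : ℝ) < m := by exact_mod_cast hm
  have hk' : (1 : ℝ) ≤ k := by exact_mod_cast hk
  have hlog : 0 ≤ Real.log m := Real.log_natCast_nonneg m
  have hsum := HasUnbiased.sum (S := S) (n := m + k) (Finset.range (k - 1))
    (fun i P => ∑ s, P s *
      binomExp (m + i + 1) (fun j => if j ≤ i then -logCoeff m k i else 0) (P s))
    (fun _ => 2 * (9 ^ k / (k : ℝ) ^ 2 / m)) fun i hi => by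
      have hi' := Finset.mem_range.1 hi
      refine (HasUnbiased.binomExp_le S hm i ?_).mono_left (by positivity) (by omega)
      rw [abs_neg]
      exact abs_logCoeff_mul_le (by omega)
  have h := ((HasUnbiased.harmonic S hm).mono_left (N := m + k) (by positivity) (by omega)).add hsum
  obtain ⟨F, hF, hFq⟩ := h
  refine ⟨F, fun x i a => (hF x i a).trans ?_, fun P hP => ?_⟩
  · have h1 : ∑ i ∈ Finset.range (k - 1), 2 * ((9 : ℝ) ^ k / (k : ℝ) ^ 2 / m) ≤
        k * (2 * (9 ^ k / (k : ℝ) ^ 2 / m)) := by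
      rw [Finset.sum_const, Finset.card_range, nsmul_eq_mul]
      gcongr
      omega
    have h2 : (k : ℝ) * (2 * (9 ^ k / (k : ℝ) ^ 2 / m)) = 2 * 9 ^ k / m / k := by field_simp
    have h3 : (2 : ℝ) * 9 ^ k / m / k ≤ 2 * 9 ^ k / m := div_le_self (by positivity) hk'
    have h4 : 2 * (1 + Real.log m + 9 ^ k) / m = 2 * ((1 + Real.log m) / m) + 2 * 9 ^ k / m := by
      ring
    rw [h4]
    linarith
  · rw [hFq P hP]
    dsimp only
    rw [Finset.sum_comm, ← Finset.sum_add_distrib]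
    refine Finset.sum_congr rfl fun s _ => ?_
    have hneg : ∀ i, binomExp (m + i + 1) (fun j => if j ≤ i then -logCoeff m k i else 0) (P s) =
        -binomExp (m + i + 1) (fun j => if j ≤ i then logCoeff m k i else 0) (P s) := by
      intro i
      rw [← neg_one_mul (binomExp _ _ _), ← binomExp.const_mul]
      congr 1
      funext j
      split_ifs <;> simp
    simp only [hneg, _root_.logApprox, mul_neg, Finset.sum_neg_distrib, mul_sub, Finset.mul_sum]
    ring

theorem stmt17 (ε : ℝ) (hε : 0 < ε) :
    ∃ C₀ : ℝ, 0 < C₀ ∧ ∀ S n : ℕ, 1 ≤ S → 2 ≤ n →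
      ∃ est : (Fin n → Fin S) → ℝ,
        ∀ P ∈ simplex S,
          iidExp P (fun x => |est x - shannonEntropy P|) ≤
            C₀ * ((S : ℝ) / ((n : ℝ) * Real.log n) +
              (n : ℝ) ^ ε * min (Real.sqrt ((S : ℝ) / (n : ℝ))) ((n : ℝ) ^ (-(1/3 : ℝ)))) := by
  set c : ℝ := min (1 / 4) (ε / 3) with hc
  have hc0 : 0 < c := lt_min (by norm_num) (by positivity)
  have hc4 : c ≤ 1 / 4 := min_le_left _ _
  have hcε : 3 * c ≤ ε := by linarith [min_le_right (1 / 4) (ε / 3)]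
  refine ⟨20 / c + (80 + 8 / ε), by positivity, fun S n hS hn => ?_⟩
  have hn2 : (2 : ℝ) ≤ n := by exact_mod_cast hn
  have hn0 : (0 : ℝ) < n := by linarith
  have hS1 : (1 : ℝ) ≤ S := by exact_mod_cast hS
  set L := Real.log n with hL
  have hL0 : 0 < L := Real.log_pos (by linarith)
  have hLn : L ≤ n - 1 := Real.log_le_sub_one_of_pos hn0
  set k : ℕ := ⌊c * L⌋₊ + 1 with hkdef
  have hk : 0 < k := Nat.succ_pos _
  have hfl : (⌊c * L⌋₊ : ℝ) ≤ c * L := Nat.floor_le (by positivity)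
  have hkR : (k : ℝ) = ⌊c * L⌋₊ + 1 := by rw [hkdef]; push_cast; ring
  have hkc : c * L ≤ k := by rw [hkR]; exact (Nat.lt_floor_add_one _).le
  have hcL : c * L ≤ (n - 1) / 4 := by nlinarith
  have hkn : k < n := by
    have : (k : ℝ) < n := by rw [hkR]; linarith
    exact_mod_cast this
  obtain ⟨m, hm⟩ : ∃ m, m + k = n := ⟨n - k, by omega⟩
  have hm0 : 0 < m := by omega
  have hmR : (m : ℝ) + k = n := by exact_mod_cast hm
  have hm4 : (n : ℝ) / 4 ≤ m := by rw [hkR] at hmR; linarith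
  have hmn : (m : ℝ) ≤ n := by linarith [(Nat.cast_nonneg k : (0 : ℝ) ≤ k)]
  have hm0' : (0 : ℝ) < m := by exact_mod_cast hm0
  have hk0' : (0 : ℝ) < k := by exact_mod_cast hk
  have hnε : 1 ≤ (n : ℝ) ^ ε := Real.one_le_rpow (by linarith) hε.le
  have hLε : L ≤ (n : ℝ) ^ ε / ε := Real.log_le_rpow_div hn0.le hε
  have h9 : (9 : ℝ) ^ k ≤ 9 * (n : ℝ) ^ ε := by
    rw [hkdef, pow_succ, mul_comm]
    refine mul_le_mul_of_nonneg_left ?_ (by norm_num)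
    calc (9 : ℝ) ^ ⌊c * L⌋₊ ≤ Real.exp 3 ^ ⌊c * L⌋₊ := pow_le_pow_left₀ (by norm_num) nine_le_exp_three _
      _ = Real.exp (⌊c * L⌋₊ * 3) := (Real.exp_nat_mul _ _).symm
      _ ≤ Real.exp (L * ε) := Real.exp_le_exp.2 (by nlinarith)
      _ = (n : ℝ) ^ ε := (Real.rpow_def_of_pos hn0 ε).symm
  set d : ℝ := 2 * (1 + Real.log m + 9 ^ k) / m with hd
  have hlogm : Real.log m ≤ L := Real.log_le_log hm0' hmn
  have hlogm0 : 0 ≤ Real.log m := Real.log_natCast_nonneg m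
  have hd0 : 0 < d := by positivity
  have hdle : d ≤ (80 + 8 / ε) * (n : ℝ) ^ ε / n := by
    calc d ≤ 2 * ((n : ℝ) ^ ε + (n : ℝ) ^ ε / ε + 9 * (n : ℝ) ^ ε) / (n / 4) := by
          rw [hd]
          gcongr
          exact hlogm.trans hLε
      _ = (80 + 8 / ε) * (n : ℝ) ^ ε / n := by field_simp; ring
  have hU := HasUnbiased.logApprox S hm0 hk
  rw [hm] at hU
  obtain ⟨F, hF, hFq⟩ := hU
  refine ⟨F, fun P hP => ?_⟩
  have hbias : |iidExp P F - shannonEntropy P| ≤ 20 / c * (S / (n * L)) := by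
    have hle1 : ∀ s, P s ≤ 1 := fun s => by
      rw [← hP.2]
      exact Finset.single_le_sum (fun i _ => hP.1 i) (Finset.mem_univ s)
    rw [hFq P hP, shannonEntropy, ← Finset.sum_sub_distrib]
    calc |∑ s, (P s * logApprox m k (P s) - -(P s * Real.log (P s)))|
        ≤ ∑ s, |P s * logApprox m k (P s) - -(P s * Real.log (P s))| :=
          Finset.abs_sum_le_sum_abs _ _
      _ ≤ ∑ _s : Fin S, 5 / ((m : ℝ) * k) := by
          refine Finset.sum_le_sum fun s _ => ?_
          rw [sub_neg_eq_add, ← mul_add, abs_mul, abs_of_nonneg (hP.1 s)]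
          exact mul_abs_logApprox_add_log_le hm0 hk (hP.1 s) (hle1 s)
      _ = S * (5 / ((m : ℝ) * k)) := by simp
      _ ≤ S * (5 / ((n / 4) * (c * L))) := by gcongr
      _ = 20 / c * (S / (n * L)) := by field_simp; ring
  have hrate : 1 / √(n : ℝ) ≤ min (√((S : ℝ) / n)) ((n : ℝ) ^ (-(1 / 3 : ℝ))) := by
    refine le_min ?_ ?_
    · rw [Real.sqrt_div (by positivity)]
      gcongr
      exact Real.one_le_sqrt.2 hS1
    · rw [Real.sqrt_eq_rpow, one_div, ← Real.rpow_neg hn0.le]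
      exact Real.rpow_le_rpow_of_exponent_le (by linarith) (by norm_num)
  have hdev : d * √(n : ℝ) ≤ (80 + 8 / ε) *
      ((n : ℝ) ^ ε * min (√((S : ℝ) / n)) ((n : ℝ) ^ (-(1 / 3 : ℝ)))) := by
    calc d * √(n : ℝ) ≤ (80 + 8 / ε) * (n : ℝ) ^ ε / n * √(n : ℝ) := by gcongr
      _ = (80 + 8 / ε) * ((n : ℝ) ^ ε * (1 / √(n : ℝ))) := by
          have h1 : √(n : ℝ) ≠ 0 := (Real.sqrt_pos.2 hn0).ne'
          have h2 := Real.sq_sqrt hn0.le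
          field_simp
          rw [h2]
      _ ≤ _ := by gcongr
  have hA : 0 ≤ (S : ℝ) / (n * L) := by positivity
  have hB : 0 ≤ (n : ℝ) ^ ε * min (√((S : ℝ) / n)) ((n : ℝ) ^ (-(1 / 3 : ℝ))) := by positivity
  calc iidExp P (fun x => |F x - shannonEntropy P|)
      ≤ iidExp P (fun x => |F x - iidExp P F| + |iidExp P F - shannonEntropy P|) :=
        iidExp_mono hP fun x => abs_sub_le _ _ _
    _ = iidExp P (fun x => |F x - iidExp P F|) + |iidExp P F - shannonEntropy P| := by
        rw [iidExp_add, iidExp_const hP]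
    _ ≤ d * √(n : ℝ) + 20 / c * (S / (n * L)) :=
        add_le_add (hF.mean_abs_sub_le hP hd0 (by omega)) hbias
    _ ≤ _ := by
        have h1 : 0 ≤ 20 / c := by positivity
        have h2 : 0 ≤ 80 + 8 / ε := by positivity
        have := mul_nonneg h2 hA
        have := mul_nonneg h1 hB
        linarith
end

section
/- For every ε > 0 there exist constants C₀ > 0, c > 0, and C > 0 such that for all integers k ≥ 2 and n with 2 ≤ n ≤ C·k·ln k, there exists an estimator Ŝ (a measurable real-valued function of n i.i.d. samples from P) satisfying sup over P ∈ D_k of E_P | Ŝ − S(P) | ≤ C₀ · k · ( exp( −c·√( n ln k / k ) ) + n^ε / √k ), where S(P) = Σ_i 𝟙(p_i ≠ 0) is the support size and D_k is the collection of discrete probability vectors P = (p₁,…,p_S) (of arbitrary finite length S) whose nonzero entries all satisfy p_i ≥ 1/k. -/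
/-- A finitely supported discrete probability distribution (on the countable label set ℕ)
whose nonzero masses are all at least `1/k`: the class `D_k`. -/
def Dk (k : ℕ) : Set (ℕ → ℝ) :=
  {P | (∀ i, 0 ≤ P i) ∧ (Function.support P).Finite ∧ (∑' i, P i) = 1 ∧
    ∀ i, P i ≠ 0 → 1 / (k : ℝ) ≤ P i}

/-- The support size `S(P) = Σ_i 𝟙(p_i ≠ 0)`. -/
noncomputable def suppSize (P : ℕ → ℝ) : ℕ := Nat.card (Function.support P)

section ProductExpectation

variable {α : Type*} [Fintype α]

/-- The expectation of `f` over `n` independent draws with weights `w`. -/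
def prodExp (w : α → ℝ) (n : ℕ) (f : (Fin n → α) → ℝ) : ℝ :=
  ∑ x, (∏ m, w (x m)) * f x

lemma prodExp_succ (w : α → ℝ) (n : ℕ) (f : (Fin (n + 1) → α) → ℝ) :
    prodExp w (n + 1) f = ∑ a, w a * prodExp w n (fun x => f (Fin.cons a x)) := by
  unfold prodExp
  rw [← Equiv.sum_comp (Fin.consEquiv fun _ => α), Fintype.sum_prod_type]
  refine Finset.sum_congr rfl fun a _ => ?_
  rw [Finset.mul_sum]
  refine Finset.sum_congr rfl fun x _ => ?_
  simp [Fin.consEquiv, Fin.prod_univ_succ, mul_assoc]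

lemma prodExp_mono {w : α → ℝ} (hw : ∀ a, 0 ≤ w a) {n : ℕ} {f g : (Fin n → α) → ℝ}
    (h : ∀ x, f x ≤ g x) : prodExp w n f ≤ prodExp w n g :=
  Finset.sum_le_sum fun x _ =>
    mul_le_mul_of_nonneg_left (h x) (Finset.prod_nonneg fun m _ => hw (x m))

lemma prodExp_add (w : α → ℝ) {n : ℕ} (f g : (Fin n → α) → ℝ) :
    prodExp w n (fun x => f x + g x) = prodExp w n f + prodExp w n g := by
  simp [prodExp, mul_add, Finset.sum_add_distrib]

lemma prodExp_const_mul (w : α → ℝ) {n : ℕ} (c : ℝ) (f : (Fin n → α) → ℝ) :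
    prodExp w n (fun x => c * f x) = c * prodExp w n f := by
  simp [prodExp, Finset.mul_sum, mul_left_comm]

lemma prodExp_sum {ι : Type*} (s : Finset ι) (w : α → ℝ) {n : ℕ}
    (f : ι → (Fin n → α) → ℝ) :
    prodExp w n (fun x => ∑ i ∈ s, f i x) = ∑ i ∈ s, prodExp w n (f i) := by
  simp only [prodExp, Finset.mul_sum]
  exact Finset.sum_comm

lemma prodExp_const {w : α → ℝ} (hw : ∑ a, w a = 1) (n : ℕ) (c : ℝ) :
    prodExp w n (fun _ => c) = c := by
  induction n with
  | zero => simp [prodExp]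
  | succ n ih => rw [prodExp_succ]; simp [ih, ← Finset.sum_mul, hw]

lemma prodExp_sq_sub {w : α → ℝ} (hw : ∑ a, w a = 1) {n : ℕ} (f : (Fin n → α) → ℝ) (μ : ℝ) :
    prodExp w n (fun x => (f x - μ) ^ 2) =
      prodExp w n (fun x => (f x - prodExp w n f) ^ 2) + (prodExp w n f - μ) ^ 2 := by
  have key (ν : ℝ) : prodExp w n (fun x => (f x - ν) ^ 2) =
      prodExp w n (fun x => f x ^ 2) + (-2 * ν) * prodExp w n f + ν ^ 2 := by
    rw [← prodExp_const_mul, ← prodExp_add]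
    conv_rhs => rw [← prodExp_const hw n (ν ^ 2), ← prodExp_add]
    congr 1
    ext x
    ring
  rw [key, key]
  ring

/-- The variance of a function with bounded differences. -/
lemma prodExp_variance_le [DecidableEq α] {w : α → ℝ} (hw0 : ∀ a, 0 ≤ w a)
    (hw : ∑ a, w a = 1) {c : ℝ} (n : ℕ) (f : (Fin n → α) → ℝ)
    (hf : ∀ x m a, |f (Function.update x m a) - f x| ≤ c) :
    prodExp w n (fun x => (f x - prodExp w n f) ^ 2) ≤ n * c ^ 2 := by
  induction n with
  | zero => simp [prodExp]
  | succ n ih =>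
    set h : α → ℝ := fun a => prodExp w n (fun x => f (Fin.cons a x)) with hh
    have hdiff (a b : α) : h a - h b ≤ c := by
      have : h a ≤ prodExp w n (fun x => f (Fin.cons b x) + c) := by
        refine prodExp_mono hw0 fun x => ?_
        have := hf (Fin.cons b x) 0 a
        rw [Fin.update_cons_zero] at this
        linarith [le_abs_self (f (Fin.cons a x) - f (Fin.cons b x))]
      rw [prodExp_add, prodExp_const hw] at this
      linarith
    have hμ : prodExp w (n + 1) f = ∑ b, w b * h b := prodExp_succ w n f
    have hle (a : α) : (h a - prodExp w (n + 1) f) ^ 2 ≤ c ^ 2 := by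
      have e : h a - prodExp w (n + 1) f = ∑ b, w b * (h a - h b) := by
        simp [mul_sub, Finset.sum_sub_distrib, ← Finset.sum_mul, hw, hμ]
      have up : ∑ b, w b * (h a - h b) ≤ ∑ b, w b * c :=
        Finset.sum_le_sum fun b _ => mul_le_mul_of_nonneg_left (hdiff a b) (hw0 b)
      have lo : ∑ b, w b * -c ≤ ∑ b, w b * (h a - h b) :=
        Finset.sum_le_sum fun b _ =>
          mul_le_mul_of_nonneg_left (by linarith [hdiff b a]) (hw0 b)
      rw [← Finset.sum_mul, hw] at up lo
      rw [e]
      exact sq_le_sq' (by linarith) (by linarith)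
    rw [prodExp_succ]
    calc ∑ a, w a * prodExp w n (fun x => (f (Fin.cons a x) - prodExp w (n + 1) f) ^ 2)
        ≤ ∑ a, w a * ((n : ℝ) * c ^ 2 + c ^ 2) := by
          refine Finset.sum_le_sum fun a _ => mul_le_mul_of_nonneg_left ?_ (hw0 a)
          rw [prodExp_sq_sub hw (fun x => f (Fin.cons a x))]
          refine add_le_add (ih _ fun x m b => ?_) (hle a)
          rw [Fin.cons_update]
          exact hf _ _ _
      _ = ((n + 1 : ℕ) : ℝ) * c ^ 2 := by
          rw [← Finset.sum_mul, hw]; push_cast; ring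

lemma prodExp_abs_sub_le [DecidableEq α] {w : α → ℝ} (hw0 : ∀ a, 0 ≤ w a)
    (hw : ∑ a, w a = 1) {c : ℝ} (hc : 0 < c) {n : ℕ} (hn : 0 < n) (f : (Fin n → α) → ℝ)
    (hf : ∀ x m a, |f (Function.update x m a) - f x| ≤ c) (s : ℝ) :
    prodExp w n (fun x => |f x - s|) ≤ √n * c + |prodExp w n f - s| := by
  set μ := prodExp w n f with hμ
  set σ := √n * c with hσ
  have hσ0 : 0 < σ := by positivity
  have hσ2 : (n : ℝ) * c ^ 2 = σ ^ 2 := by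
    rw [hσ, mul_pow, Real.sq_sqrt (Nat.cast_nonneg n)]
  have hvar := prodExp_variance_le hw0 hw n f hf
  rw [hσ2, ← hμ] at hvar
  calc prodExp w n (fun x => |f x - s|)
      ≤ prodExp w n (fun x => (2 * σ)⁻¹ * (f x - μ) ^ 2 + (σ / 2 + |μ - s|)) := by
        refine prodExp_mono hw0 fun x => ?_
        have h1 : |f x - s| ≤ |f x - μ| + |μ - s| := abs_sub_le _ _ _
        have h2 : |f x - μ| ≤ (2 * σ)⁻¹ * (f x - μ) ^ 2 + σ / 2 := by
          rw [← sq_abs (f x - μ)]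
          have : (2 * σ)⁻¹ * |f x - μ| ^ 2 + σ / 2 - |f x - μ|
              = (2 * σ)⁻¹ * (|f x - μ| - σ) ^ 2 := by field_simp; ring
          have h3 : 0 ≤ (2 * σ)⁻¹ * (|f x - μ| - σ) ^ 2 := by positivity
          linarith
        linarith
    _ = (2 * σ)⁻¹ * prodExp w n (fun x => (f x - μ) ^ 2) + (σ / 2 + |μ - s|) := by
        rw [prodExp_add, prodExp_const hw, prodExp_const_mul]
    _ ≤ (2 * σ)⁻¹ * σ ^ 2 + (σ / 2 + |μ - s|) := by gcongr
    _ = σ + |μ - s| := by field_simp; ring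

/-- The number of occurrences of `a` among the draws is binomially distributed. -/
lemma prodExp_count [DecidableEq α] {w : α → ℝ} (hw : ∑ a, w a = 1) (a : α) (n : ℕ)
    (h : ℕ → ℝ) :
    prodExp w n (fun x => h (Finset.univ.filter fun m => x m = a).card) =
      ∑ j ∈ Finset.range (n + 1), (n.choose j : ℝ) * (w a ^ j * (1 - w a) ^ (n - j) * h j) := by
  induction n generalizing h with
  | zero => simp [prodExp]
  | succ n ih =>
    rw [prodExp_succ, Finset.sum_choose_succ_mul
      (fun i j => w a ^ i * (1 - w a) ^ j * h i) n]
    have hb (b : α) : w b * prodExp w n (fun x => h (Finset.univ.filter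
        fun m => (Fin.cons b x : Fin (n + 1) → α) m = a).card) =
        w b * prodExp w n (fun x => h (Finset.univ.filter fun m => x m = a).card) +
        if b = a then w b * (prodExp w n (fun x => h ((Finset.univ.filter fun m => x m = a).card
          + 1)) - prodExp w n (fun x => h (Finset.univ.filter fun m => x m = a).card)) else 0 := by
      simp only [Fin.card_filter_univ_succ, Fin.cons_zero, Fin.cons_succ]
      split_ifs with hba
      · ring
      · ring
    rw [Finset.sum_congr rfl fun b _ => hb b, Finset.sum_add_distrib, ← Finset.sum_mul, hw,
      Finset.sum_ite_eq' Finset.univ a, if_pos (Finset.mem_univ a), ih h, ih fun j => h (j + 1)]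
    have e1 : ∑ i ∈ Finset.range (n + 1), (n.choose i : ℝ) *
        (w a ^ i * (1 - w a) ^ (n + 1 - i) * h i) = (1 - w a) * ∑ i ∈ Finset.range (n + 1),
        (n.choose i : ℝ) * (w a ^ i * (1 - w a) ^ (n - i) * h i) := by
      rw [Finset.mul_sum]
      refine Finset.sum_congr rfl fun i hi => ?_
      rw [Nat.sub_add_comm (Nat.lt_succ_iff.mp (Finset.mem_range.mp hi)), pow_succ]
      ring
    have e2 : ∑ i ∈ Finset.range (n + 1), (n.choose i : ℝ) *
        (w a ^ (i + 1) * (1 - w a) ^ (n - i) * h (i + 1)) = w a * ∑ i ∈ Finset.range (n + 1),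
        (n.choose i : ℝ) * (w a ^ i * (1 - w a) ^ (n - i) * h (i + 1)) := by
      rw [Finset.mul_sum]
      refine Finset.sum_congr rfl fun i _ => ?_
      ring
    rw [e1, e2]
    ring

/-- Replacing one draw changes an additive function of the counts by at most four times the
bound on its summands. -/
lemma abs_sum_count_update_sub_le [DecidableEq α] {n : ℕ} {g : ℕ → ℝ} {M : ℝ}
    (hg : ∀ j, |g j| ≤ M) (x : Fin n → α) (m : Fin n) (a : α) :
    |∑ b, g (Finset.univ.filter fun i => Function.update x m a i = b).card -
      ∑ b, g (Finset.univ.filter fun i => x i = b).card| ≤ 4 * M := by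
  have hM : 0 ≤ M := (abs_nonneg _).trans (hg 0)
  rw [← Finset.sum_sub_distrib]
  calc _ ≤ ∑ b, |g (Finset.univ.filter fun i => Function.update x m a i = b).card -
          g (Finset.univ.filter fun i => x i = b).card| := Finset.abs_sum_le_sum_abs _ _
    _ ≤ ∑ b, ((if b = a then 2 * M else 0) + if b = x m then 2 * M else 0) := by
        refine Finset.sum_le_sum fun b _ => ?_
        by_cases hb : b = a ∨ b = x m
        · have h1 : |g (Finset.univ.filter fun i => Function.update x m a i = b).card -
              g (Finset.univ.filter fun i => x i = b).card| ≤ 2 * M := by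
            refine (abs_sub _ _).trans ?_
            linarith [hg (Finset.univ.filter fun i => Function.update x m a i = b).card,
              hg (Finset.univ.filter fun i => x i = b).card]
          refine h1.trans ?_
          rcases hb with hb | hb
          · rw [if_pos hb]; split_ifs <;> linarith
          · rw [if_pos hb]; split_ifs <;> linarith
        · push Not at hb
          have : (Finset.univ.filter fun i => Function.update x m a i = b) =
              Finset.univ.filter fun i => x i = b := by
            ext i
            by_cases hi : i = m
            · subst hi; simp [hb.1.symm, hb.2.symm]
            · simp [hi]
          rw [this]
          simp [hb.1, hb.2]
    _ = 4 * M := by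
        rw [Finset.sum_add_distrib, Finset.sum_ite_eq' Finset.univ a,
          Finset.sum_ite_eq' Finset.univ (x m)]
        simp; ring

end ProductExpectation

section Chebyshev

open Polynomial

lemma abs_eval_chebyshev_le_one {x : ℝ} (hx : |x| ≤ 1) (L : ℕ) :
    |(Chebyshev.T ℝ L).eval x| ≤ 1 := by
  rw [abs_le] at hx
  rw [← Real.cos_arccos hx.1 hx.2, Chebyshev.T_real_cos]
  exact Real.abs_cos_le_one _

lemma abs_eval_chebyshev_le {y : ℝ} (hy : 1 ≤ |y|) (L : ℕ) :
    |(Chebyshev.T ℝ L).eval y| ≤ (3 * |y|) ^ L := by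
  induction L using Nat.twoStepInduction with
  | zero => simp
  | one => simp; linarith
  | more L h0 h1 =>
    push_cast at h1 ⊢
    rw [Chebyshev.T_add_two]
    simp only [eval_sub, eval_mul, eval_ofNat, eval_X]
    refine (abs_sub _ _).trans ?_
    rw [abs_mul, abs_mul, abs_two]
    have h2 : 0 ≤ (3 * |y|) ^ L := by positivity
    have h3 : 2 * |y| * |(Chebyshev.T ℝ (L + 1)).eval y| ≤ 2 * |y| * (3 * |y|) ^ (L + 1) := by
      gcongr
    have h4 : 2 * |y| * (3 * |y|) ^ (L + 1) + (3 * |y|) ^ L = (3 * |y|) ^ L * (6 * |y| ^ 2 + 1) := by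
      ring
    have h5 : (3 * |y|) ^ (L + 2) = (3 * |y|) ^ L * (9 * |y| ^ 2) := by ring
    rw [h5]
    refine (add_le_add h3 h0).trans ?_
    rw [h4]
    gcongr
    nlinarith

lemma half_exp_le_eval_chebyshev {δ y : ℝ} (h0 : 0 ≤ δ) (h1 : δ ≤ 1) (hy : 1 + δ ≤ y) (L : ℕ) :
    Real.exp (L * √δ) / 2 ≤ (Chebyshev.T ℝ L).eval y := by
  have hy1 : 1 ≤ y := by linarith
  have hc : Real.cosh √δ ≤ y := by
    refine (Real.cosh_le_exp_half_sq _).trans ?_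
    rw [Real.sq_sqrt h0]
    have := Real.exp_bound_div_one_sub_of_interval (x := δ / 2) (by linarith) (by linarith)
    refine this.trans ?_
    rw [div_le_iff₀ (by linarith)]
    nlinarith
  have hle : √δ ≤ Real.arcosh y := by
    rw [← Real.arcosh_cosh (Real.sqrt_nonneg δ)]
    exact (Real.arcosh_le_arcosh (Real.cosh_pos _) (by linarith)).2 hc
  rw [← Real.cosh_arcosh hy1, Chebyshev.T_real_cosh, Real.cosh_eq]
  have : Real.exp (L * √δ) ≤ Real.exp ((L : ℤ) * Real.arcosh y) := by
    push_cast
    gcongr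
  have h3 := Real.exp_pos (-((L : ℤ) * Real.arcosh y))
  linarith

/-- The polynomial `(1 + X) ^ L * T_L ((α + γ X) / (1 + X))`. -/
noncomputable def chebyshevHom (α γ : ℝ) : ℕ → ℝ[X]
  | 0 => 1
  | 1 => C α + C γ * X
  | L + 2 => 2 * (C α + C γ * X) * chebyshevHom α γ (L + 1) - (1 + X) ^ 2 * chebyshevHom α γ L

lemma eval_chebyshevHom (α γ : ℝ) {x : ℝ} (hx : 1 + x ≠ 0) (L : ℕ) :
    (chebyshevHom α γ L).eval x =
      (1 + x) ^ L * (Chebyshev.T ℝ L).eval ((α + γ * x) / (1 + x)) := by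
  induction L using Nat.twoStepInduction with
  | zero => simp [chebyshevHom]
  | one => simp [chebyshevHom]; field_simp
  | more L h0 h1 =>
    push_cast at h1 ⊢
    rw [Chebyshev.T_add_two, chebyshevHom]
    simp only [eval_sub, eval_mul, eval_ofNat, eval_X, eval_add, eval_C, eval_pow, eval_one, h0,
      h1]
    generalize (Chebyshev.T ℝ (L + 1)).eval _ = u
    generalize (Chebyshev.T ℝ L).eval _ = v
    field_simp
    ring

lemma natDegree_chebyshevHom_le (α γ : ℝ) (L : ℕ) : (chebyshevHom α γ L).natDegree ≤ L := by
  induction L using Nat.twoStepInduction with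
  | zero => simp [chebyshevHom]
  | one => rw [chebyshevHom]; compute_degree
  | more L h0 h1 =>
    rw [chebyshevHom]
    refine (natDegree_sub_le _ _).trans (max_le ?_ ?_)
    · have : (2 * (C α + C γ * X) : ℝ[X]).natDegree ≤ 1 := by compute_degree
      exact (natDegree_mul_le_of_le this h1).trans (by omega)
    · have : ((1 + X) ^ 2 : ℝ[X]).natDegree ≤ 2 := by compute_degree
      exact (natDegree_mul_le_of_le this h0).trans (by omega)

lemma abs_coeff_chebyshevHom_le {α γ r : ℝ} (hr : 0 < r) (hr1 : r ≤ 1) (hα : |α| ≤ 3)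
    (hγ : |γ| ≤ 4 / r) (L j : ℕ) : |(chebyshevHom α γ L).coeff j| ≤ 21 ^ L * (1 / r) ^ j := by
  have hR : 1 ≤ 1 / r := by rw [le_div_iff₀ hr]; linarith
  rw [← mul_one_div] at hγ
  set R := 1 / r
  induction L using Nat.twoStepInduction generalizing j with
  | zero =>
    rw [chebyshevHom, coeff_one]
    split_ifs with h
    · simp [h]
    · simp; positivity
  | one =>
    rw [chebyshevHom]
    match j with
    | 0 => simp; linarith
    | 1 => simp; linarith
    | j + 2 => simp; positivity
  | more L h0 h1 =>
    have e : chebyshevHom α γ (L + 2) = C (2 * α) * chebyshevHom α γ (L + 1)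
        + C (2 * γ) * (chebyshevHom α γ (L + 1) * X)
        - (chebyshevHom α γ L + C 2 * (chebyshevHom α γ L * X)
          + chebyshevHom α γ L * X * X) := by
      rw [chebyshevHom]; simp only [map_mul, map_ofNat]; ring
    set B := chebyshevHom α γ (L + 1)
    set D := chebyshevHom α γ L
    have hX {Q : ℝ[X]} {K : ℝ} (hQ : ∀ j, |Q.coeff j| ≤ K * R ^ j) (j : ℕ) :
        |(Q * X).coeff j| * R ≤ K * R ^ j := by
      have hK : 0 ≤ K := by simpa using (abs_nonneg _).trans (hQ 0)
      match j with
      | 0 => simpa using hK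
      | j + 1 => rw [coeff_mul_X, pow_succ, ← mul_assoc]; gcongr; exact hQ j
    have hX' {Q : ℝ[X]} {K : ℝ} (hQ : ∀ j, |Q.coeff j| ≤ K * R ^ j) (j : ℕ) :
        |(Q * X).coeff j| ≤ K * R ^ j :=
      (le_mul_of_one_le_right (abs_nonneg _) hR).trans (hX hQ j)
    have b0 := h1 j
    have b1 := hX h1 j
    have d0 := h0 j
    have d1 := hX' h0 j
    have d2 := hX' (hX' h0) j
    rw [e]
    simp only [coeff_sub, coeff_add, coeff_C_mul]
    have t1 : |2 * α * B.coeff j| ≤ 6 * (21 ^ (L + 1) * R ^ j) := by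
      rw [abs_mul, abs_mul, abs_two]
      exact mul_le_mul (by linarith) b0 (abs_nonneg _) (by norm_num)
    have t2 : |2 * γ * (B * X).coeff j| ≤ 8 * (21 ^ (L + 1) * R ^ j) := by
      rw [abs_mul, abs_mul, abs_two]
      calc 2 * |γ| * |(B * X).coeff j| ≤ 2 * (4 * R) * |(B * X).coeff j| := by gcongr
        _ = 8 * (|(B * X).coeff j| * R) := by ring
        _ ≤ _ := by gcongr
    have t3 : |2 * (D * X).coeff j| ≤ 2 * (21 ^ L * R ^ j) := by
      rw [abs_mul, abs_two]; gcongr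
    have hp : (21 : ℝ) ^ (L + 2) * R ^ j = 441 * (21 ^ L * R ^ j) := by ring
    have hp' : (21 : ℝ) ^ (L + 1) * R ^ j = 21 * (21 ^ L * R ^ j) := by ring
    have hnn : 0 ≤ 21 ^ L * R ^ j := by positivity
    rw [hp]
    rw [hp'] at t1 t2
    have hs := abs_sub (2 * α * B.coeff j + 2 * γ * (B * X).coeff j)
      (D.coeff j + 2 * (D * X).coeff j + (D * X * X).coeff j)
    have hs1 := abs_add_le (2 * α * B.coeff j) (2 * γ * (B * X).coeff j)
    have hs2 := abs_add_three (D.coeff j) (2 * (D * X).coeff j) ((D * X * X).coeff j)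
    linarith

end Chebyshev

section Estimator

open Polynomial

lemma sum_coeff_mul_bernstein {Q : ℝ[X]} {n : ℕ} (hQ : Q.natDegree ≤ n) {p : ℝ} (hp : p < 1) :
    ∑ j ∈ Finset.range (n + 1), Q.coeff j * (p ^ j * (1 - p) ^ (n - j)) =
      (1 - p) ^ n * Q.eval (p / (1 - p)) := by
  rw [eval_eq_sum_range' (Nat.lt_succ_of_le hQ), Finset.mul_sum]
  refine Finset.sum_congr rfl fun j hj => ?_
  have hj' : j ≤ n := Nat.lt_succ_iff.mp (Finset.mem_range.mp hj)
  have h1 : 1 - p ≠ 0 := by linarith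
  rw [div_pow, ← Nat.sub_add_cancel hj', pow_add, Nat.add_sub_cancel]
  field_simp

lemma abs_pow_mul_eval_chebyshev_le_one {l r p : ℝ} {n L : ℕ} (hl : 0 < l) (hlr : 2 * l ≤ r)
    (hL : 24 * L ≤ n) (hrn : r * n = 24 * L) (hp : l ≤ p) (hp1 : p < 1) :
    |(1 - p) ^ (n - L) * (Chebyshev.T ℝ L).eval ((r + l - 2 * p) / (r - l))| ≤ 1 := by
  have hrl : 0 < r - l := by linarith
  have hr : 0 < r := by linarith
  have h0 : 0 ≤ 1 - p := by linarith
  rw [abs_mul, abs_of_nonneg (pow_nonneg h0 _)]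
  rcases le_total p r with hpr | hpr
  · have : |(r + l - 2 * p) / (r - l)| ≤ 1 := by
      rw [abs_div, abs_of_pos hrl, div_le_one hrl, abs_le]
      constructor <;> linarith
    exact mul_le_one₀ (pow_le_one₀ h0 (by linarith)) (abs_nonneg _)
      (abs_eval_chebyshev_le_one this L)
  · have habs : |(r + l - 2 * p) / (r - l)| = (2 * p - r - l) / (r - l) := by
      rw [abs_div, abs_of_pos hrl, abs_of_nonpos (by linarith)]
      ring
    have h1 : 1 ≤ |(r + l - 2 * p) / (r - l)| := by
      rw [habs, le_div_iff₀ hrl]; linarith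
    have h2 : |(r + l - 2 * p) / (r - l)| ≤ 4 * (p / r) := by
      rw [habs, div_le_iff₀ hrl]
      have : 4 * (p / r) * (r - l) = 4 * p - 4 * p * l / r := by field_simp
      rw [this]
      have : 4 * p * l / r ≤ 2 * p := by
        rw [div_le_iff₀ hr]; nlinarith
      linarith
    have hu : 0 < p / r := div_pos (by linarith) hr
    have h3 : |(Chebyshev.T ℝ L).eval ((r + l - 2 * p) / (r - l))| ≤ (12 * (p / r)) ^ L := by
      refine (abs_eval_chebyshev_le h1 L).trans (pow_le_pow_left₀ (by positivity) ?_ L)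
      linarith
    have h4 : (1 - p) ^ (n - L) ≤ Real.exp (-(12 * (p / r))) ^ L := by
      calc (1 - p) ^ (n - L) ≤ Real.exp (-p) ^ (n - L) := by
            gcongr
            exact Real.one_sub_le_exp_neg p
        _ = Real.exp (((n - L : ℕ) : ℝ) * -p) := (Real.exp_nat_mul _ _).symm
        _ ≤ Real.exp (L * -(12 * (p / r))) := by
            rw [Real.exp_le_exp, Nat.cast_sub (by omega)]
            have h5 : (L : ℝ) * (12 * (p / r)) = n / 2 * p := by
              field_simp
              linear_combination (-p) * hrn
            have h6 : (24 : ℝ) * L ≤ n := by exact_mod_cast hL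
            have h7 : (0 : ℝ) ≤ L := Nat.cast_nonneg L
            have : (L : ℝ) * -(12 * (p / r)) = -(n / 2 * p) := by rw [mul_neg, h5]
            rw [this]
            have hp0 : 0 ≤ p := by linarith
            nlinarith
        _ = _ := Real.exp_nat_mul _ _
    calc _ ≤ Real.exp (-(12 * (p / r))) ^ L * (12 * (p / r)) ^ L := by gcongr
      _ = (Real.exp (-(12 * (p / r))) * (12 * (p / r))) ^ L := (mul_pow _ _ _).symm
      _ ≤ 1 := by
          refine pow_le_one₀ (by positivity) ?_
          rw [Real.exp_neg, inv_mul_le_one₀ (Real.exp_pos _)]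
          linarith [Real.add_one_le_exp (12 * (p / r))]

lemma abs_sum_coeff_chebyshevHom_le_one {l r p : ℝ} {n L : ℕ} (hl : 0 < l) (hlr : 2 * l ≤ r)
    (hL1 : 1 ≤ L) (hL : 24 * L ≤ n) (hrn : r * n = 24 * L) (hp : l ≤ p) (hp1 : p ≤ 1) :
    |∑ j ∈ Finset.range (n + 1), (chebyshevHom ((r + l) / (r - l)) ((r + l - 2) / (r - l)) L).coeff
      j * (p ^ j * (1 - p) ^ (n - j))| ≤ 1 := by
  have hdeg := natDegree_chebyshevHom_le ((r + l) / (r - l)) ((r + l - 2) / (r - l)) L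
  rcases hp1.lt_or_eq with hp1 | rfl
  · rw [sum_coeff_mul_bernstein (by omega) hp1]
    have h1 : 1 - p ≠ 0 := by linarith
    have h2 : 1 + p / (1 - p) = (1 - p)⁻¹ := by field_simp; ring
    have hrl : r - l ≠ 0 := by linarith
    rw [eval_chebyshevHom _ _ (by rw [h2]; exact inv_ne_zero h1), h2, ← mul_assoc,
      show (1 - p) ^ n * (1 - p)⁻¹ ^ L = (1 - p) ^ (n - L) by
        rw [inv_pow, pow_sub₀ _ h1 (by omega)]]
    have h3 : ((r + l) / (r - l) + (r + l - 2) / (r - l) * (p / (1 - p))) / (1 - p)⁻¹ =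
        (r + l - 2 * p) / (r - l) := by
      field_simp; ring
    rw [h3]
    exact abs_pow_mul_eval_chebyshev_le_one hl hlr hL hrn hp hp1
  · rw [Finset.sum_eq_zero]
    · simp
    · intro j hj
      have hj' : j ≤ n := Nat.lt_succ_iff.mp (Finset.mem_range.mp hj)
      rcases hj'.lt_or_eq with h | rfl
      · rw [sub_self, zero_pow (by omega)]; ring
      · rw [coeff_eq_zero_of_natDegree_lt (by omega)]; ring

lemma one_div_pow_le_choose {r : ℝ} {n L j : ℕ} (hr : 0 < r) (hL1 : 1 ≤ L) (hL : 24 * L ≤ n)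
    (hrn : r * n = 24 * L) (hj : j ≤ L) : (1 / r) ^ j ≤ (n.choose j : ℝ) := by
  refine le_trans ?_ (Nat.pow_le_choose j n)
  rw [le_div_iff₀ (by positivity)]
  have hL0 : (0 : ℝ) < L := by exact_mod_cast hL1
  have h1 : ((j.factorial : ℕ) : ℝ) ≤ (L : ℝ) ^ j := by
    have : j.factorial ≤ L ^ j := (Nat.factorial_le_pow j).trans (Nat.pow_le_pow_left hj j)
    exact_mod_cast this
  calc (1 / r) ^ j * (j.factorial : ℝ) ≤ (1 / r) ^ j * (L : ℝ) ^ j := by gcongr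
    _ = (1 / r * L) ^ j := (mul_pow _ _ _).symm
    _ ≤ ((n + 1 - j : ℕ) : ℝ) ^ j := by
      have h2 : 1 / r * (L : ℝ) = n / 24 := by
        field_simp; linarith
      rw [h2]
      gcongr
      rw [div_le_iff₀ (by norm_num)]
      have : n ≤ (n + 1 - j) * 24 := by omega
      exact_mod_cast this

lemma abs_coeff_chebyshevHom_div_choose_le {l r : ℝ} {n L : ℕ} (hl : 0 < l) (hlr : 2 * l ≤ r)
    (hL1 : 1 ≤ L) (hL : 24 * L ≤ n) (hrn : r * n = 24 * L) (j : ℕ) :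
    |(chebyshevHom ((r + l) / (r - l)) ((r + l - 2) / (r - l)) L).coeff j / (n.choose j : ℝ)| ≤
      21 ^ L := by
  have hrl : 0 < r - l := by linarith
  have hr : 0 < r := by linarith
  have hn : (0 : ℝ) < n := by
    have : 0 < n := by omega
    exact_mod_cast this
  have hr1 : r ≤ 1 := by
    have : (24 : ℝ) * L ≤ n := by exact_mod_cast hL
    by_contra! h
    nlinarith
  rcases le_or_gt j L with hj | hj
  · have hα : |(r + l) / (r - l)| ≤ 3 := by
      rw [abs_of_pos (by positivity), div_le_iff₀ hrl]; linarith
    have hγ : |(r + l - 2) / (r - l)| ≤ 4 / r := by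
      rw [abs_div, abs_of_pos hrl, abs_of_nonpos (by linarith), div_le_div_iff₀ hrl hr]
      nlinarith
    have hc := one_div_pow_le_choose hr hL1 hL hrn hj
    have hpos : (0 : ℝ) < (1 / r) ^ j := by positivity
    rw [abs_div, Nat.abs_cast, div_le_iff₀ (hpos.trans_le hc)]
    exact (abs_coeff_chebyshevHom_le hr hr1 hα hγ L j).trans (by gcongr)
  · rw [coeff_eq_zero_of_natDegree_lt ((natDegree_chebyshevHom_le _ _ L).trans_lt hj)]
    simp

lemma tsum_prod_mul_eq_prodExp {P : ℕ → ℝ} [Fintype (Function.support P)] (n : ℕ)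
    (F : (Fin n → ℕ) → ℝ) :
    ∑' x : Fin n → ℕ, (∏ m, P (x m)) * F x =
      prodExp (fun a : Function.support P => P a) n (fun y => F fun m => y m) := by
  have hinj : Function.Injective
      (fun (y : Fin n → Function.support P) (m : Fin n) => (y m : ℕ)) :=
    fun y z h => funext fun m => Subtype.ext (congrFun h m)
  rw [← hinj.tsum_eq, tsum_fintype, prodExp]
  intro x hx
  have hx' : ∀ m, x m ∈ Function.support P := fun m =>
    Finset.prod_ne_zero_iff.mp (left_ne_zero_of_mul hx) m (Finset.mem_univ m)
  exact ⟨fun m => ⟨x m, hx' m⟩, rfl⟩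

lemma sum_support_eq_one {k : ℕ} {P : ℕ → ℝ} (hP : P ∈ Dk k) [Fintype (Function.support P)] :
    ∑ a : Function.support P, P a = 1 := by
  rw [← hP.2.2.1, ← tsum_subtype_support, tsum_fintype]

lemma suppSize_le {k : ℕ} (hk : 0 < k) {P : ℕ → ℝ} (hP : P ∈ Dk k) : (suppSize P : ℝ) ≤ k := by
  have : Finite (Function.support P) := hP.2.1
  have := Fintype.ofFinite (Function.support P)
  have h : ∑ _a : Function.support P, 1 / (k : ℝ) ≤ ∑ a : Function.support P, P a :=
    Finset.sum_le_sum fun a _ => hP.2.2.2 a a.2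
  rw [sum_support_eq_one hP] at h
  have hk' : (0 : ℝ) < k := by exact_mod_cast hk
  simp only [Finset.sum_const, Finset.card_univ, nsmul_eq_mul, mul_one_div] at h
  rw [div_le_one hk'] at h
  rwa [suppSize, Nat.card_eq_fintype_card]

/-- The zero estimator has risk at most `k`. -/
lemma risk_zero_le {k n : ℕ} (hk : 0 < k) {P : ℕ → ℝ} (hP : P ∈ Dk k) :
    ∑' x : Fin n → ℕ, (∏ m, P (x m)) * |(0 : ℝ) - (suppSize P : ℝ)| ≤ k := by
  have : Finite (Function.support P) := hP.2.1
  have := Fintype.ofFinite (Function.support P)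
  rw [tsum_prod_mul_eq_prodExp n fun _ => |(0 : ℝ) - (suppSize P : ℝ)|,
    prodExp_const (sum_support_eq_one hP)]
  simpa using suppSize_le hk hP

lemma sum_image_count_eq {s : Set ℕ} [Fintype s] {n : ℕ} {g : ℕ → ℝ} (hg : g 0 = 0)
    (y : Fin n → s) :
    ∑ b ∈ Finset.univ.image (fun m => (y m : ℕ)),
        g (Finset.univ.filter fun m => (y m : ℕ) = b).card =
      ∑ b : s, g (Finset.univ.filter fun m => y m = b).card := by
  classical
  have e (b : s) : (Finset.univ.filter fun m => y m = b) =
      Finset.univ.filter fun m => (y m : ℕ) = b := by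
    ext m; simp [Subtype.ext_iff]
  simp only [e]
  rw [← Finset.sum_subtype s.toFinset (fun _ => Set.mem_toFinset)
    (fun b => g (Finset.univ.filter fun m => (y m : ℕ) = b).card)]
  refine Finset.sum_subset (fun b hb => ?_) fun b _ hb => ?_
  · obtain ⟨m, -, rfl⟩ := Finset.mem_image.mp hb
    simp
  · rw [Finset.filter_eq_empty_iff.mpr, Finset.card_empty, hg]
    intro m _ hm
    exact hb (Finset.mem_image.mpr ⟨m, Finset.mem_univ m, hm⟩)

/-- The risk of the Chebyshev polynomial estimator of degree `L`. -/
lemma exists_estimator_risk_le {k n L : ℕ} (hk : 0 < k) (hL1 : 1 ≤ L) (hL : 24 * L ≤ n)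
    (hnk : n ≤ 12 * L * k) :
    ∃ est : (Fin n → ℕ) → ℝ, ∀ P ∈ Dk k,
      ∑' x : Fin n → ℕ, (∏ m, P (x m)) * |est x - (suppSize P : ℝ)| ≤
        √n * (12 * 21 ^ L) + 2 * k * Real.exp (-√(L * n / (24 * k))) := by
  have hk' : (0 : ℝ) < k := by exact_mod_cast hk
  have hL0 : (0 : ℝ) < L := by exact_mod_cast hL1
  have hn0 : 0 < n := by omega
  have hn : (0 : ℝ) < n := by exact_mod_cast hn0
  have hnk' : (n : ℝ) ≤ 12 * L * k := by exact_mod_cast hnk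
  set l : ℝ := 1 / k with hldef
  set r : ℝ := 24 * L / n with hrdef
  have hl : 0 < l := by positivity
  have hr : 0 < r := by positivity
  have hrn : r * n = 24 * L := by rw [hrdef]; field_simp
  have hlr : 2 * l ≤ r := by
    rw [hldef, hrdef, mul_one_div, div_le_div_iff₀ hk' hn]; linarith
  have hrl : 0 < r - l := by linarith
  set α := (r + l) / (r - l) with hα
  set Q := chebyshevHom α ((r + l - 2) / (r - l)) L with hQ
  set τ := (Chebyshev.T ℝ L).eval α with hτ
  have hQ0 : Q.coeff 0 = τ := by
    rw [coeff_zero_eq_eval_zero, hQ, eval_chebyshevHom _ _ (by norm_num)]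
    simp [hτ]
  have hδ1 : l / r ≤ 1 := by rw [div_le_one hr]; linarith
  have hδα : 1 + l / r ≤ α := by
    rw [hα, le_div_iff₀ hrl]
    have : (1 + l / r) * (r - l) = r - l * (l / r) := by field_simp; ring
    rw [this]
    have : 0 ≤ l * (l / r) := by positivity
    linarith
  have hexp : Real.exp (√(L * n / (24 * k))) / 2 ≤ τ := by
    have h := half_exp_le_eval_chebyshev (by positivity) hδ1 hδα L
    have e : (L : ℝ) * √(l / r) = √(L * n / (24 * k)) := by
      have : (L : ℝ) * n / (24 * k) = (L : ℝ) ^ 2 * (l / r) := by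
        rw [hldef, hrdef]; field_simp
      rw [this, Real.sqrt_mul (by positivity), Real.sqrt_sq hL0.le]
    rwa [e] at h
  have hτ2 : 1 / 2 ≤ τ := by
    have := Real.one_le_exp (Real.sqrt_nonneg (L * n / (24 * k)))
    linarith
  have hτ0 : 0 < τ := by linarith
  set g : ℕ → ℝ := fun j => 1 - Q.coeff j / (n.choose j : ℝ) / τ with hg
  have hg0 : g 0 = 0 := by simp [hg, hQ0, hτ0.ne']
  have hgM (j : ℕ) : |g j| ≤ 3 * 21 ^ L := by
    have h1 : |Q.coeff j / (n.choose j : ℝ)| ≤ 21 ^ L :=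
      abs_coeff_chebyshevHom_div_choose_le hl hlr hL1 hL hrn j
    have h2 : |Q.coeff j / (n.choose j : ℝ) / τ| ≤ 2 * 21 ^ L := by
      rw [abs_div, abs_of_pos hτ0, div_le_iff₀ hτ0]
      refine h1.trans ?_
      have : (0 : ℝ) < 21 ^ L := by positivity
      nlinarith
    have h3 : (1 : ℝ) ≤ 21 ^ L := one_le_pow₀ (by norm_num)
    refine (abs_sub _ _).trans ?_
    rw [abs_one]
    linarith
  refine ⟨fun x => ∑ b ∈ Finset.univ.image x, g (Finset.univ.filter fun m => x m = b).card,
    fun P hP => ?_⟩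
  classical
  have : Finite (Function.support P) := hP.2.1
  have := Fintype.ofFinite (Function.support P)
  set w : Function.support P → ℝ := fun a => P a with hw
  have hw0 (a) : 0 ≤ w a := hP.1 a
  have hw1 : ∑ a, w a = 1 := sum_support_eq_one hP
  rw [tsum_prod_mul_eq_prodExp n fun x => |(∑ b ∈ Finset.univ.image x,
    g (Finset.univ.filter fun m => x m = b).card) - (suppSize P : ℝ)|]
  simp only [sum_image_count_eq hg0]
  set f : (Fin n → Function.support P) → ℝ :=
    fun y => ∑ b, g (Finset.univ.filter fun m => y m = b).card with hf
  have hmain := prodExp_abs_sub_le hw0 hw1 (c := 4 * (3 * 21 ^ L)) (by positivity) hn0 f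
    (abs_sum_count_update_sub_le hgM) (suppSize P)
  have hterm (a : Function.support P) :
      |prodExp w n (fun y => g (Finset.univ.filter fun m => y m = a).card) - 1| ≤ 1 / τ := by
    have hone : ∑ j ∈ Finset.range (n + 1),
        (n.choose j : ℝ) * (w a ^ j * (1 - w a) ^ (n - j) * 1) = 1 := by
      rw [← prodExp_count hw1 a n fun _ => 1, prodExp_const hw1]
    have hsum : prodExp w n (fun y => g (Finset.univ.filter fun m => y m = a).card) - 1 =
        -((∑ j ∈ Finset.range (n + 1), Q.coeff j * (w a ^ j * (1 - w a) ^ (n - j))) / τ) := by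
      rw [prodExp_count hw1]
      refine (congrArg (_ - ·) hone.symm).trans ?_
      rw [← Finset.sum_sub_distrib, Finset.sum_div, ← Finset.sum_neg_distrib]
      refine Finset.sum_congr rfl fun j hj => ?_
      have hc : (n.choose j : ℝ) ≠ 0 := by
        have := Nat.choose_pos (Nat.lt_succ_iff.mp (Finset.mem_range.mp hj))
        exact_mod_cast this.ne'
      simp only [hg]
      field_simp
      ring
    have hwa1 : w a ≤ 1 := by
      rw [← hw1]
      exact Finset.single_le_sum (fun b _ => hw0 b) (Finset.mem_univ a)
    rw [hsum, abs_neg, abs_div, abs_of_pos hτ0]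
    gcongr
    exact abs_sum_coeff_chebyshevHom_le_one hl hlr hL1 hL hrn (hP.2.2.2 a a.2) hwa1
  have hbias : |prodExp w n f - suppSize P| ≤ 2 * k * Real.exp (-√(L * n / (24 * k))) := by
    have hcard : (suppSize P : ℝ) = ∑ _a : Function.support P, (1 : ℝ) := by
      simp [suppSize]
    have h1 : |prodExp w n f - suppSize P| ≤ suppSize P * (1 / τ) := by
      rw [hf, prodExp_sum, hcard, ← Finset.sum_sub_distrib, Finset.sum_mul, one_mul]
      exact (Finset.abs_sum_le_sum_abs _ _).trans (Finset.sum_le_sum fun a _ => hterm a)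
    have h2 : 1 / τ ≤ 2 * Real.exp (-√(L * n / (24 * k))) := by
      rw [div_le_iff₀ hτ0, Real.exp_neg]
      have := Real.exp_pos (√(L * n / (24 * k)))
      rw [mul_right_comm, ← div_eq_mul_inv, le_div_iff₀ this]
      linarith
    calc _ ≤ (suppSize P : ℝ) * (1 / τ) := h1
      _ ≤ k * (2 * Real.exp (-√(L * n / (24 * k)))) := by
        gcongr
        exact_mod_cast suppSize_le hk hP
      _ = _ := by ring
  linarith

end Estimator

lemma log_le_two_mul_sqrt {x : ℝ} (hx : 0 < x) : Real.log x ≤ 2 * √x := by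
  have h := Real.log_le_sub_one_of_pos (Real.sqrt_pos.2 hx)
  rw [Real.log_sqrt hx.le] at h
  linarith

lemma twentyone_pow_ceil_le {a x : ℝ} (ha : 0 ≤ a) (hx : 1 ≤ x) :
    (21 : ℝ) ^ ⌈a * Real.log x⌉₊ ≤ 21 * x ^ (4 * a) := by
  have hx0 : 0 < x := by linarith
  have hlog : 0 ≤ a * Real.log x := mul_nonneg ha (Real.log_nonneg hx)
  have h21 : Real.log 21 ≤ 4 := by
    rw [Real.log_le_iff_le_exp (by norm_num)]
    have h1 : (2.7 : ℝ) ^ 4 ≤ Real.exp 1 ^ 4 := by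
      gcongr
      linarith [Real.exp_one_gt_d9]
    rw [← Real.exp_nat_mul] at h1
    norm_num at h1 ⊢
    linarith
  calc (21 : ℝ) ^ ⌈a * Real.log x⌉₊ = (21 : ℝ) ^ ((⌈a * Real.log x⌉₊ : ℕ) : ℝ) :=
        (Real.rpow_natCast _ _).symm
    _ ≤ (21 : ℝ) ^ (a * Real.log x + 1) := by
        gcongr
        · norm_num
        · exact (Nat.ceil_lt_add_one hlog).le
    _ = 21 * (21 : ℝ) ^ (a * Real.log x) := by
        rw [Real.rpow_add (by norm_num), Real.rpow_one, mul_comm]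
    _ ≤ 21 * x ^ (4 * a) := by
        gcongr
        rw [Real.rpow_def_of_pos (by norm_num), Real.rpow_def_of_pos hx0, Real.exp_le_exp]
        nlinarith

/-- The standard deviation bound in the regime `k ≤ 4 n ^ 2`, `n ≲ k log k`. -/
lemma sqrt_mul_twentyone_pow_le {ε k n : ℝ} (hε : 0 < ε) (hk : 1 ≤ k) (hn : 0 < n)
    (hkn : k ≤ 4 * n ^ 2) (hnk : n ≤ 12 * (ε / 16) * k * Real.log k) :
    √n * (12 * 21 ^ ⌈ε / 16 * Real.log k⌉₊) ≤ 504 * 4 ^ (ε / 2) * (√k * n ^ ε) := by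
  have hk0 : 0 < k := by linarith
  have h1 : √n ≤ 2 * (√k * k ^ (ε / 4)) := by
    rw [Real.sqrt_le_left (by positivity), mul_pow, mul_pow, Real.sq_sqrt hk0.le,
      ← Real.rpow_natCast (k ^ (ε / 4)), ← Real.rpow_mul hk0.le]
    have hlog := Real.log_le_rpow_div hk0.le (half_pos hε)
    rw [le_div_iff₀ (half_pos hε)] at hlog
    have e : ε / 4 * ((2 : ℕ) : ℝ) = ε / 2 := by push_cast; ring
    rw [e]
    have hpow : 0 < k ^ (ε / 2) := by positivity
    nlinarith
  have h2 := twentyone_pow_ceil_le (a := ε / 16) (by positivity) hk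
  rw [show 4 * (ε / 16) = ε / 4 by ring] at h2
  have h3 : k ^ (ε / 4) * k ^ (ε / 4) ≤ 4 ^ (ε / 2) * n ^ ε := by
    rw [← Real.rpow_add hk0, show ε / 4 + ε / 4 = ε / 2 by ring]
    calc k ^ (ε / 2) ≤ (4 * n ^ 2) ^ (ε / 2) := by gcongr
      _ = 4 ^ (ε / 2) * n ^ ε := by
        rw [Real.mul_rpow (by norm_num) (by positivity), ← Real.rpow_natCast n,
          ← Real.rpow_mul hn.le]
        congr 2
        push_cast; ring
  calc √n * (12 * 21 ^ ⌈ε / 16 * Real.log k⌉₊)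
      ≤ 2 * (√k * k ^ (ε / 4)) * (12 * (21 * k ^ (ε / 4))) := by gcongr
    _ = 504 * √k * (k ^ (ε / 4) * k ^ (ε / 4)) := by ring
    _ ≤ 504 * √k * (4 ^ (ε / 2) * n ^ ε) := by gcongr
    _ = _ := by ring

lemma sqrt_le_of_lt_log {a k : ℝ} (ha : 0 ≤ a) (hk : 1 ≤ k) (h : √k ≤ 48 * (a * Real.log k + 1)) :
    √k ≤ (192 * a + 48) ^ 2 := by
  have hk0 : 0 < k := by linarith
  have hs1 : 1 ≤ √k := Real.one_le_sqrt.2 hk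
  have ht1 : 1 ≤ √√k := Real.one_le_sqrt.2 hs1
  have hlog : Real.log k ≤ 4 * √√k := by
    have h2 := log_le_two_mul_sqrt (Real.sqrt_pos.2 hk0)
    rw [Real.log_sqrt hk0.le] at h2
    linarith
  have hsq : √√k ^ 2 = √k := Real.sq_sqrt (Real.sqrt_nonneg k)
  have hle : √√k ≤ 192 * a + 48 := by
    by_contra! hcon
    nlinarith
  rw [← hsq]
  gcongr

theorem stmt19 (ε : ℝ) (hε : 0 < ε) :
    ∃ C₀ c C : ℝ, 0 < C₀ ∧ 0 < c ∧ 0 < C ∧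
      ∀ k n : ℕ, 2 ≤ k → 2 ≤ n → (n : ℝ) ≤ C * (k : ℝ) * Real.log k →
        ∃ est : (Fin n → ℕ) → ℝ,
          ∀ P ∈ Dk k,
            (∑' x : Fin n → ℕ, (∏ m, P (x m)) * |est x - (suppSize P : ℝ)|) ≤
              C₀ * (k : ℝ) *
                (Real.exp (-c * Real.sqrt ((n : ℝ) * Real.log k / k)) +
                  (n : ℝ) ^ ε / Real.sqrt k) := by
  set a := ε / 16 with ha
  set c := √(a / 24) with hc
  set B := (192 * a + 48) ^ 2 with hB
  set K := 504 * (4 : ℝ) ^ (ε / 2) with hK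
  have ha0 : 0 < a := by positivity
  refine ⟨Real.exp c + B + K + 2, c, 12 * a, by positivity, by positivity, by positivity, ?_⟩
  intro k n hk hn hnk
  have hk1 : (1 : ℝ) < k := by exact_mod_cast hk
  have hk0 : (0 : ℝ) < k := by linarith
  have hn1 : (1 : ℝ) ≤ n := by exact_mod_cast (by omega : 1 ≤ n)
  have hn0 : (0 : ℝ) < n := by linarith
  have hlog : 0 < Real.log k := Real.log_pos hk1
  have hnε : 1 ≤ (n : ℝ) ^ ε := Real.one_le_rpow hn1 hε.le
  have hsk : 0 < √(k : ℝ) := Real.sqrt_pos.2 hk0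
  set E := Real.exp (-c * √(n * Real.log k / k)) with hE
  set V := (n : ℝ) ^ ε / √k with hV
  have hE0 : 0 < E := Real.exp_pos _
  have hV0 : 0 < V := by positivity
  have hB0 : 0 < B := by positivity
  have hK0 : 0 < K := by positivity
  have hec : 0 < Real.exp c := Real.exp_pos c
  by_cases h1 : n * Real.log k ≤ k
  · refine ⟨fun _ => 0, fun P hP => (risk_zero_le (by omega) hP).trans ?_⟩
    have h2 : √(n * Real.log k / k) ≤ 1 := by
      rw [Real.sqrt_le_one]
      exact (div_le_one hk0).2 h1
    have h3 : 1 ≤ Real.exp c * E := by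
      rw [hE, ← Real.exp_add]
      refine Real.one_le_exp ?_
      nlinarith [Real.sqrt_nonneg (a / 24)]
    have h4 : 1 ≤ (Real.exp c + B + K + 2) * (E + V) := by
      refine h3.trans ?_
      gcongr <;> linarith
    calc (k : ℝ) ≤ k * ((Real.exp c + B + K + 2) * (E + V)) := le_mul_of_one_le_right hk0.le h4
      _ = _ := by ring
  push Not at h1
  have hk2n : √(k : ℝ) ≤ 2 * n := by
    have h2 := log_le_two_mul_sqrt hk0
    have h3 := Real.mul_self_sqrt hk0.le
    by_contra! h4
    nlinarith
  by_cases h2 : 24 * ⌈a * Real.log k⌉₊ ≤ n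
  · have hL1 : 1 ≤ ⌈a * Real.log k⌉₊ := Nat.one_le_ceil_iff.2 (by positivity)
    have hLa : a * Real.log k ≤ ⌈a * Real.log k⌉₊ := Nat.le_ceil _
    have hnL : n ≤ 12 * ⌈a * Real.log k⌉₊ * k := by
      have : (n : ℝ) ≤ 12 * ⌈a * Real.log k⌉₊ * k := by
        refine hnk.trans ?_
        calc 12 * a * k * Real.log k = 12 * (a * Real.log k) * k := by ring
          _ ≤ _ := by gcongr
      exact_mod_cast this
    obtain ⟨est, hest⟩ := exists_estimator_risk_le (by omega) hL1 h2 hnL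
    refine ⟨est, fun P hP => (hest P hP).trans ?_⟩
    have hvar : √(n : ℝ) * (12 * 21 ^ ⌈a * Real.log k⌉₊) ≤ K * (√k * n ^ ε) := by
      refine sqrt_mul_twentyone_pow_le hε hk1.le hn0 ?_ hnk
      calc (k : ℝ) = √k ^ 2 := (Real.sq_sqrt hk0.le).symm
        _ ≤ (2 * n) ^ 2 := by gcongr
        _ = _ := by ring
    have hkV : √(k : ℝ) * n ^ ε = k * V := by
      rw [hV]
      field_simp
      rw [Real.sq_sqrt hk0.le]
    rw [hkV] at hvar
    have hexp : Real.exp (-√(⌈a * Real.log k⌉₊ * n / (24 * k))) ≤ E := by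
      rw [hE, neg_mul, Real.exp_le_exp, neg_le_neg_iff, hc, ← Real.sqrt_mul (by positivity)]
      refine Real.sqrt_le_sqrt ?_
      calc a / 24 * (n * Real.log k / k) = a * Real.log k * n / (24 * k) := by field_simp
        _ ≤ _ := by gcongr
    calc _ ≤ K * (k * V) + 2 * k * E := by gcongr
      _ ≤ (Real.exp c + B + K + 2) * k * (E + V) := by
        have e : (Real.exp c + B + K + 2) * k * (E + V) = K * (k * V) + 2 * k * E +
          ((Real.exp c + B + K) * k * E + (Real.exp c + B + 2) * k * V) := by ring
        rw [e]
        exact le_add_of_nonneg_right (by positivity)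
  · push Not at h2
    refine ⟨fun _ => 0, fun P hP => (risk_zero_le (by omega) hP).trans ?_⟩
    have h3 : (n : ℝ) < 24 * ⌈a * Real.log k⌉₊ := by exact_mod_cast h2
    have h4 := Nat.ceil_lt_add_one (by positivity : 0 ≤ a * Real.log k)
    have h5 : √(k : ℝ) ≤ B := sqrt_le_of_lt_log ha0.le hk1.le (by linarith)
    have h6 : 1 ≤ B * V := by
      rw [hV, mul_div_assoc', one_le_div hsk]
      nlinarith
    have h7 : 1 ≤ (Real.exp c + B + K + 2) * (E + V) := by
      refine h6.trans ?_
      gcongr <;> linarith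
    calc (k : ℝ) ≤ k * ((Real.exp c + B + K + 2) * (E + V)) := le_mul_of_one_le_right hk0.le h7
      _ = _ := by ring
end
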